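/- arXiv:1207.5126 — 2 statements merged into one kernel-verified Lean document; each statement's English description precedes it below -/
import Mathlib

section
/- Let W : ℝ → (0,∞] be a weight (lower semicontinuous, not identically ∞), and let 𝓛 be a linear subspace of C₀(W) that is invariant under complex conjugation (f ∈ 𝓛 implies conj f ∈ 𝓛). Assume the closure of 𝓛 in C₀(W) is not all of C₀(W). Then there exists a positive Borel measure μ ≠ 0 on ℝ such that: (i) ∫_ℝ W dμ < ∞; (ii) the annihilator of 𝓛 ⊆ L¹(μ) with respect to the duality between L¹(μ) and L^∞(μ) is one-dimensional, and is spanned by a function g₀ ∈ L^∞(μ) with |g₀(x)| = 1 for μ-almost all x ∈ ℝ. -/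
open Filter MeasureTheory
open scoped ENNReal NNReal

/-- A weight: a lower semicontinuous function `W : ℝ → (0,∞]` not identically `∞`. -/
def IsWeight (W : ℝ → ℝ≥0∞) : Prop :=
  LowerSemicontinuous W ∧ (∀ x, 0 < W x) ∧ ¬ (∀ x, W x = ⊤)

/-- Membership in `C₀(W)` for an extended weight: `f : ℝ → ℂ` continuous with
`|f(x)|/W(x) → 0` as `|x| → ∞` (the quotient taken in `ℝ≥0∞` is `0` where `W = ∞`). -/
def MemC0e (W : ℝ → ℝ≥0∞) (f : ℝ → ℂ) : Prop :=
  Continuous f ∧ Tendsto (fun x => (‖f x‖₊ : ℝ≥0∞) / W x) (cocompact ℝ) (nhds 0)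

/-- The seminorm of `C₀(W)`: `‖f‖ = sup_x |f(x)|/W(x)` (computed in `ℝ≥0∞`). -/
noncomputable def eC0norm (W : ℝ → ℝ≥0∞) (f : ℝ → ℂ) : ℝ≥0∞ :=
  ⨆ x : ℝ, (‖f x‖₊ : ℝ≥0∞) / W x

/-- Hahn–Banach with a distance bound: a vector at sublinear distance at least `δ` from a subspace
is separated from it by a functional dominated by `N`. -/
theorem exists_dominated_functional_ne_zero {E : Type*} [AddCommGroup E] [Module ℝ E]
    {N : E → ℝ} (hN : ∀ x, 0 ≤ N x) (N_hom : ∀ c : ℝ, 0 < c → ∀ x, N (c • x) = c * N x)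
    (N_add : ∀ x y, N (x + y) ≤ N x + N y) (M : Submodule ℝ E) {x₀ : E} {δ : ℝ} (hδ : 0 < δ)
    (hdist : ∀ m ∈ M, δ ≤ N (x₀ + m)) :
    ∃ φ : E →ₗ[ℝ] ℝ, (∀ x, φ x ≤ N x) ∧ (∀ m ∈ M, φ m = 0) ∧ φ x₀ = δ := by
  have hx₀ : x₀ ∉ M := fun h ↦ by
    have h0 : N 0 = 0 := by
      have := N_hom 2 two_pos 0
      rw [smul_zero] at this; linarith
    have := hdist (-x₀) (M.neg_mem h)
    rw [add_neg_cancel, h0] at this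
    linarith
  let f₀ : E →ₗ.[ℝ] ℝ := ⟨M, 0⟩
  let f := f₀.supSpanSingleton x₀ δ hx₀
  obtain ⟨g, hg, hgN⟩ := exists_extension_of_le_sublinear f N N_hom N_add (by
    rintro ⟨x, hx⟩
    obtain ⟨m, hm, y, hy, rfl⟩ := Submodule.mem_sup.1 hx
    obtain ⟨c, rfl⟩ := Submodule.mem_span_singleton.1 hy
    have h1 : f ⟨m + c • x₀, hx⟩ = c * δ := by
      exact (f₀.supSpanSingleton_apply_mk x₀ δ hx₀ m hm c).trans (by simp [f₀])
    rw [h1]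
    rcases le_or_gt c 0 with hc | hc
    · exact (mul_nonpos_of_nonpos_of_nonneg hc hδ.le).trans (hN _)
    · have h2 : m + c • x₀ = c • (x₀ + c⁻¹ • m) := by
        rw [smul_add, smul_inv_smul₀ hc.ne', add_comm]
      change c * δ ≤ N (m + c • x₀)
      rw [h2, N_hom c hc]
      exact mul_le_mul_of_nonneg_left (hdist _ (M.smul_mem _ hm)) hc.le)
  refine ⟨g, hgN, fun m hm ↦ ?_, ?_⟩
  · have := hg ⟨m, Submodule.mem_sup_left hm⟩
    rw [show g m = _ from this]
    exact f₀.supSpanSingleton_apply_mk_of_mem (x := x₀) δ hx₀ hm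
  · have := hg ⟨x₀, Submodule.mem_sup_right (Submodule.mem_span_singleton_self _)⟩
    rw [show g x₀ = _ from this]
    exact f₀.supSpanSingleton_apply_self δ hx₀

/-- Among the functionals dominated by `N` and vanishing on `M`, there is an extreme one which does
not vanish at a vector `x₀` at positive distance from `M`. -/
theorem exists_extreme_dominated_functional {E : Type*} [AddCommGroup E] [Module ℝ E]
    {N : E → ℝ} (hN : ∀ x, 0 ≤ N x) (N_hom : ∀ c : ℝ, 0 < c → ∀ x, N (c • x) = c * N x)
    (N_add : ∀ x y, N (x + y) ≤ N x + N y) (M : Submodule ℝ E) {x₀ : E} {δ : ℝ} (hδ : 0 < δ)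
    (hdist : ∀ m ∈ M, δ ≤ N (x₀ + m)) :
    ∃ φ : E →ₗ[ℝ] ℝ, (∀ x, φ x ≤ N x) ∧ (∀ m ∈ M, φ m = 0) ∧ 0 < φ x₀ ∧
      ∀ ψ : E →ₗ[ℝ] ℝ, (∀ x, φ x + ψ x ≤ N x) → (∀ x, φ x - ψ x ≤ N x) →
        (∀ m ∈ M, ψ m = 0) → ψ = 0 := by
  obtain ⟨φ₀, hφ₀N, hφ₀M, hφ₀⟩ :=
    exists_dominated_functional_ne_zero hN N_hom N_add M hδ hdist
  let K : Set (E → ℝ) := {φ | (∀ x y, φ (x + y) = φ x + φ y) ∧ (∀ (c : ℝ) x, φ (c • x) = c * φ x) ∧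
    (∀ x, φ x ≤ N x) ∧ ∀ m ∈ M, φ m = 0}
  have hKclosed : IsClosed K := by
    have h : K = (⋂ x, ⋂ y, {φ | φ (x + y) = φ x + φ y}) ∩
        ((⋂ c : ℝ, ⋂ x, {φ | φ (c • x) = c * φ x}) ∩
        ((⋂ x, {φ | φ x ≤ N x}) ∩ ⋂ m ∈ M, {φ | φ m = 0})) := by
      ext φ; simp [K]
    rw [h]
    refine (isClosed_iInter fun x ↦ isClosed_iInter fun y ↦ isClosed_eq ?_ ?_).inter
      ((isClosed_iInter fun c ↦ isClosed_iInter fun x ↦ isClosed_eq ?_ ?_).inter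
      ((isClosed_iInter fun x ↦ isClosed_le ?_ ?_).inter
      (isClosed_biInter fun m _ ↦ isClosed_eq ?_ ?_))) <;> fun_prop
  have hKcompact : IsCompact K := by
    refine (isCompact_univ_pi fun x ↦ isCompact_Icc (a := -N (-x)) (b := N x)).of_isClosed_subset
      hKclosed ?_
    rintro φ ⟨-, hsmul, hle, -⟩ x -
    refine ⟨?_, hle x⟩
    have h1 := hsmul (-1) x
    rw [neg_one_smul] at h1
    have h2 := hle (-x)
    linarith
  obtain ⟨φm, hφmK, hφm⟩ := hKcompact.exists_isMaxOn (f := fun φ : E → ℝ ↦ φ x₀)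
    ⟨φ₀, map_add φ₀, fun c x ↦ by simp, hφ₀N, hφ₀M⟩ (by fun_prop)
  let K' : Set (E → ℝ) := K ∩ {φ | φ x₀ = φm x₀}
  have hK'compact : IsCompact K' :=
    hKcompact.inter_right (isClosed_eq (by fun_prop) (by fun_prop))
  obtain ⟨φ, ⟨⟨hadd, hsmul, hle, hM⟩, hφx₀⟩, hext⟩ :=
    hK'compact.extremePoints_nonempty ⟨φm, hφmK, rfl⟩
  refine ⟨⟨⟨φ, hadd⟩, hsmul⟩, hle, hM, ?_, fun ψ h1 h2 h3 ↦ ?_⟩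
  · have : φ₀ x₀ ≤ φm x₀ := hφm ⟨map_add φ₀, fun c x ↦ by simp, hφ₀N, hφ₀M⟩
    change 0 < φ x₀
    rw [hφx₀]
    linarith
  · have hp : (fun x ↦ φ x + ψ x) ∈ K :=
      ⟨fun x y ↦ by simp only [hadd, map_add]; ring,
        fun c x ↦ by simp only [hsmul, map_smul, smul_eq_mul]; ring, h1,
        fun m hm ↦ by simp only [hM m hm, h3 m hm, add_zero]⟩
    have hn : (fun x ↦ φ x - ψ x) ∈ K :=
      ⟨fun x y ↦ by simp only [hadd, map_add]; ring,
        fun c x ↦ by simp only [hsmul, map_smul, smul_eq_mul]; ring, h2,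
        fun m hm ↦ by simp only [hM m hm, h3 m hm, sub_zero]⟩
    have hp' : φ x₀ + ψ x₀ ≤ φm x₀ := hφm hp
    have hn' : φ x₀ - ψ x₀ ≤ φm x₀ := hφm hn
    have hφx₀' : φ x₀ = φm x₀ := hφx₀
    have key := hext ⟨hp, show φ x₀ + ψ x₀ = φm x₀ by linarith⟩
      ⟨hn, show φ x₀ - ψ x₀ = φm x₀ by linarith⟩
      ⟨1 / 2, 1 / 2, by norm_num, by norm_num, by norm_num, by
        ext x; simp only [Pi.add_apply, Pi.smul_apply, smul_eq_mul]; ring⟩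
    ext x
    have := congrFun key x
    simpa using this

/-- A continuous cutoff, equal to `1` for `|x| ≤ n - 1` and to `0` for `|x| ≥ n`. -/
noncomputable def cutoff (n : ℕ) (x : ℝ) : ℝ := max 0 (min 1 (n - |x|))

theorem continuous_cutoff (n : ℕ) : Continuous (cutoff n) := by
  unfold cutoff; fun_prop

theorem cutoff_nonneg (n : ℕ) (x : ℝ) : 0 ≤ cutoff n x := le_max_left _ _

theorem cutoff_le_one (n : ℕ) (x : ℝ) : cutoff n x ≤ 1 := max_le zero_le_one (min_le_left _ _)

theorem monotone_cutoff (x : ℝ) : Monotone fun n ↦ cutoff n x := fun m n hmn ↦ by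
  have : (m : ℝ) ≤ n := by exact_mod_cast hmn
  simp only [cutoff]; gcongr

theorem cutoff_eq_one {n : ℕ} {x : ℝ} (h : |x| + 1 ≤ n) : cutoff n x = 1 := by
  rw [cutoff, min_eq_left (by linarith), max_eq_right zero_le_one]

theorem hasCompactSupport_cutoff (n : ℕ) : HasCompactSupport (cutoff n) := by
  refine HasCompactSupport.intro (isCompact_closedBall (0 : ℝ) n) fun x hx ↦ ?_
  have : (n : ℝ) < |x| := by simpa using hx
  exact max_eq_left ((min_le_right _ _).trans (by linarith))

/-- A lower semicontinuous function is the supremum of an increasing sequence of nonnegative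
compactly supported continuous functions. -/
theorem LowerSemicontinuous.exists_monotone_seq_hasCompactSupport {W : ℝ → ℝ≥0∞}
    (hW : LowerSemicontinuous W) :
    ∃ f : ℕ → ℝ → ℝ, (∀ n, Continuous (f n)) ∧ (∀ n, HasCompactSupport (f n)) ∧
      (∀ n x, 0 ≤ f n x) ∧ (∀ x, Monotone fun n ↦ f n x) ∧
      ∀ x, ⨆ n, ENNReal.ofReal (f n x) = W x := by
  let a : ℕ → ℝ → ℝ := fun n y ↦ (min (W y) n).toReal
  have ha0 : ∀ n y, 0 ≤ a n y := fun n y ↦ ENNReal.toReal_nonneg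
  have hfin : ∀ (n : ℕ) y, min (W y) n ≠ ⊤ := fun n y ↦
    ne_top_of_le_ne_top (ENNReal.natCast_ne_top n) (min_le_right _ _)
  have hamono : ∀ y, Monotone fun n ↦ a n y := fun y m n hmn ↦
    ENNReal.toReal_mono (hfin n y) (min_le_min_left _ (by exact_mod_cast hmn))
  let u : ℕ → ℝ → ℝ := fun n x ↦ ⨅ y, (a n y + n * |x - y|)
  have hbdd : ∀ (n : ℕ) x, BddBelow (Set.range fun y ↦ a n y + n * |x - y|) := fun n x ↦
    ⟨0, by rintro _ ⟨y, rfl⟩; have := ha0 n y; positivity⟩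
  have hu0 : ∀ n x, 0 ≤ u n x := fun n x ↦ le_ciInf fun y ↦ by have := ha0 n y; positivity
  have hua : ∀ n x, u n x ≤ a n x := fun n x ↦ (ciInf_le (hbdd n x) x).trans (by simp)
  have hucont : ∀ n, Continuous (u n) := fun n ↦
    (LipschitzWith.of_le_add_mul (n : ℝ≥0) fun x x' ↦ by
      rw [← sub_le_iff_le_add]
      refine le_ciInf fun y ↦ ?_
      rw [sub_le_iff_le_add]
      refine (ciInf_le (hbdd n x) y).trans ?_
      have h := abs_sub_le x x' y
      have hn : (0 : ℝ) ≤ n := n.cast_nonneg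
      rw [Real.dist_eq, NNReal.coe_natCast]
      nlinarith).continuous
  have humono : ∀ x, Monotone fun n ↦ u n x := fun x m n hmn ↦
    ciInf_mono (hbdd m x) fun y ↦ by
      have h1 : a m y ≤ a n y := hamono y hmn
      have h2 : (m : ℝ) ≤ n := by exact_mod_cast hmn
      gcongr
  refine ⟨fun n x ↦ u n x * cutoff n x, fun n ↦ (hucont n).mul (continuous_cutoff n),
    fun n ↦ (hasCompactSupport_cutoff n).mul_left,
    fun n x ↦ mul_nonneg (hu0 n x) (cutoff_nonneg n x), fun x m n hmn ↦
      mul_le_mul (humono x hmn) (monotone_cutoff x hmn) (cutoff_nonneg m x) (hu0 n x), fun x ↦ le_antisymm ?_ ?_⟩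
  · refine iSup_le fun n ↦ ?_
    calc ENNReal.ofReal (u n x * cutoff n x) ≤ ENNReal.ofReal (a n x) :=
          ENNReal.ofReal_le_ofReal
            ((mul_le_of_le_one_right (hu0 n x) (cutoff_le_one n x)).trans (hua n x))
      _ = min (W x) n := ENNReal.ofReal_toReal (hfin n x)
      _ ≤ W x := min_le_left _ _
  · refine le_of_forall_lt fun c hc ↦ ?_
    obtain ⟨b, hcb, hbW⟩ := exists_between hc
    have hb : b ≠ ⊤ := hbW.ne_top
    obtain ⟨r, hr, hball⟩ := Metric.eventually_nhds_iff.1 (hW x b hbW)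
    obtain ⟨n, hn⟩ := exists_nat_ge (max (max b.toReal (b.toReal / r)) (|x| + 1))
    have hn1 : b.toReal ≤ n := (le_max_left _ _).trans ((le_max_left _ _).trans hn)
    have hn2 : b.toReal ≤ n * r :=
      (div_le_iff₀ hr).1 ((le_max_right _ _).trans ((le_max_left _ _).trans hn))
    have hn3 : |x| + 1 ≤ n := (le_max_right _ _).trans hn
    have hbn : b ≤ n := by
      rw [← ENNReal.ofReal_toReal hb, ← ENNReal.ofReal_natCast]
      exact ENNReal.ofReal_le_ofReal hn1
    have hbu : b.toReal ≤ u n x := le_ciInf fun y ↦ by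
      rcases lt_or_ge (dist y x) r with h | h
      · have h1 : b.toReal ≤ a n y :=
          ENNReal.toReal_mono (hfin n y) (le_min (hball h).le hbn)
        have : 0 ≤ (n : ℝ) * |x - y| := by positivity
        linarith
      · rw [dist_comm, Real.dist_eq] at h
        have : (n : ℝ) * r ≤ n * |x - y| := by gcongr
        have := ha0 n y
        linarith
    refine hcb.trans_le (le_iSup_of_le n ?_)
    beta_reduce
    rw [cutoff_eq_one hn3, mul_one, ← ENNReal.ofReal_toReal hb]
    exact ENNReal.ofReal_le_ofReal hbu

theorem LowerSemicontinuous.exists_forall_inv_toReal_le {W : ℝ → ℝ≥0∞}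
    (hW : LowerSemicontinuous W) (hpos : ∀ x, 0 < W x) {K : Set ℝ} (hK : IsCompact K) :
    ∃ C, ∀ x ∈ K, (W x)⁻¹.toReal ≤ C := by
  rcases K.eq_empty_or_nonempty with rfl | hne
  · exact ⟨0, by simp⟩
  obtain ⟨a, -, ha⟩ := (hW.lowerSemicontinuousOn K).exists_isMinOn hne hK
  exact ⟨(W a)⁻¹.toReal, fun x hx ↦ ENNReal.toReal_mono
    (ENNReal.inv_ne_top.2 (hpos a).ne') (ENNReal.inv_le_inv.2 (ha hx))⟩

/-- The real-valued functions of `C₀(W)`. -/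
def weightedC0 (W : ℝ → ℝ≥0∞) : Submodule ℝ (ℝ → ℝ) where
  carrier := {f | Continuous f ∧ Tendsto (fun x ↦ f x * (W x)⁻¹.toReal) (cocompact ℝ) (nhds 0)}
  add_mem' := fun {f g} hf hg ↦ ⟨hf.1.add hg.1, by
    simpa [add_mul] using hf.2.add hg.2⟩
  zero_mem' := ⟨continuous_const, by simp⟩
  smul_mem' := fun c f hf ↦ ⟨hf.1.const_smul c, by
    simpa [mul_assoc] using hf.2.const_mul c⟩

section WeightedC0

variable {W : ℝ → ℝ≥0∞}

theorem HasCompactSupport.mem_weightedC0 {f : ℝ → ℝ} (hf : HasCompactSupport f)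
    (hc : Continuous f) : f ∈ weightedC0 W := by
  refine ⟨hc, tendsto_const_nhds.congr' ?_⟩
  have h := hasCompactSupport_iff_eventuallyEq.1 hf
  rw [coclosedCompact_eq_cocompact] at h
  filter_upwards [h] with x hx
  simp [hx]

theorem exists_forall_abs_mul_le (hW : LowerSemicontinuous W) (hpos : ∀ x, 0 < W x)
    (f : weightedC0 W) : ∃ C, ∀ x, |f.1 x * (W x)⁻¹.toReal| ≤ C := by
  have h1 : ∀ᶠ x in cocompact ℝ, |f.1 x * (W x)⁻¹.toReal| < 1 := by
    have := f.2.2.abs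
    rw [abs_zero] at this
    exact this.eventually_lt_const one_pos
  obtain ⟨K, hK, hK1⟩ := mem_cocompact.1 h1
  obtain ⟨C, hC⟩ := hW.exists_forall_inv_toReal_le hpos hK
  obtain ⟨D, hD⟩ := hK.exists_bound_of_continuousOn f.2.1.continuousOn
  refine ⟨max 1 (D * C), fun x ↦ ?_⟩
  by_cases hx : x ∈ K
  · refine le_max_of_le_right ?_
    rw [abs_mul, abs_of_nonneg (ENNReal.toReal_nonneg (a := (W x)⁻¹))]
    have h0 : 0 ≤ (W x)⁻¹.toReal := ENNReal.toReal_nonneg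
    have := hD x hx
    rw [Real.norm_eq_abs] at this
    exact mul_le_mul this (hC x hx) h0 ((abs_nonneg _).trans this)
  · exact le_max_of_le_left (le_of_lt (hK1 hx))

/-- The sublinear functional `(f, g) ↦ sup max(f, g, 0) / W` on pairs of functions of `C₀(W)`. -/
noncomputable def pairSup (F : weightedC0 W × weightedC0 W) : ℝ :=
  ⨆ x, max 0 (max (F.1.1 x * (W x)⁻¹.toReal) (F.2.1 x * (W x)⁻¹.toReal))

theorem pairSup_nonneg (F : weightedC0 W × weightedC0 W) : 0 ≤ pairSup F :=
  Real.iSup_nonneg fun _ ↦ le_max_left _ _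

theorem pairSup_le {F : weightedC0 W × weightedC0 W} {C : ℝ} (hC : 0 ≤ C)
    (h1 : ∀ x, F.1.1 x * (W x)⁻¹.toReal ≤ C) (h2 : ∀ x, F.2.1 x * (W x)⁻¹.toReal ≤ C) :
    pairSup F ≤ C :=
  Real.iSup_le (fun x ↦ max_le hC (max_le (h1 x) (h2 x))) hC

theorem bddAbove_range_pairSup (hW : LowerSemicontinuous W) (hpos : ∀ x, 0 < W x)
    (F : weightedC0 W × weightedC0 W) : BddAbove (Set.range fun x ↦
      max 0 (max (F.1.1 x * (W x)⁻¹.toReal) (F.2.1 x * (W x)⁻¹.toReal))) := by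
  obtain ⟨C, hC⟩ := exists_forall_abs_mul_le hW hpos F.1
  obtain ⟨D, hD⟩ := exists_forall_abs_mul_le hW hpos F.2
  refine ⟨max C D, ?_⟩
  rintro _ ⟨x, rfl⟩
  exact max_le (le_max_of_le_left ((abs_nonneg _).trans (hC x)))
    (max_le_max ((le_abs_self _).trans (hC x)) ((le_abs_self _).trans (hD x)))

theorem fst_mul_le_pairSup (hW : LowerSemicontinuous W) (hpos : ∀ x, 0 < W x)
    (F : weightedC0 W × weightedC0 W) (x : ℝ) : F.1.1 x * (W x)⁻¹.toReal ≤ pairSup F :=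
  ((le_max_left _ _).trans (le_max_right _ _)).trans
    (le_ciSup (bddAbove_range_pairSup hW hpos F) x)

theorem snd_mul_le_pairSup (hW : LowerSemicontinuous W) (hpos : ∀ x, 0 < W x)
    (F : weightedC0 W × weightedC0 W) (x : ℝ) : F.2.1 x * (W x)⁻¹.toReal ≤ pairSup F :=
  ((le_max_right _ _).trans (le_max_right _ _)).trans
    (le_ciSup (bddAbove_range_pairSup hW hpos F) x)

theorem pairSup_add_le (hW : LowerSemicontinuous W) (hpos : ∀ x, 0 < W x)
    (F G : weightedC0 W × weightedC0 W) : pairSup (F + G) ≤ pairSup F + pairSup G := by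
  refine pairSup_le (add_nonneg (pairSup_nonneg F) (pairSup_nonneg G)) (fun x ↦ ?_) fun x ↦ ?_
  · refine le_of_eq_of_le (add_mul _ _ _) (add_le_add ?_ ?_) <;>
      exact fst_mul_le_pairSup hW hpos _ x
  · refine le_of_eq_of_le (add_mul _ _ _) (add_le_add ?_ ?_) <;>
      exact snd_mul_le_pairSup hW hpos _ x

theorem pairSup_smul {c : ℝ} (hc : 0 < c) (F : weightedC0 W × weightedC0 W) :
    pairSup (c • F) = c * pairSup F := by
  unfold pairSup
  rw [Real.mul_iSup_of_nonneg hc.le]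
  congr 1 with x
  rw [mul_max_of_nonneg _ _ hc.le, mul_max_of_nonneg _ _ hc.le, mul_zero]
  congr 2 <;> exact mul_assoc _ _ _

attribute [irreducible] pairSup

theorem ae_ne_top_weight (hW : LowerSemicontinuous W) {μ : Measure ℝ}
    (hμ : ∫⁻ x, W x ∂μ ≠ ⊤) : ∀ᵐ x ∂μ, W x ≠ ⊤ :=
  (ae_lt_top hW.measurable hμ).mono fun _ h ↦ h.ne

theorem mul_inv_toReal_mul_toReal {x : ℝ} (hpos : 0 < W x) (hx : W x ≠ ⊤) (a : ℝ) :
    a * (W x)⁻¹.toReal * (W x).toReal = a := by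
  rw [ENNReal.toReal_inv, inv_mul_cancel_right₀ (ENNReal.toReal_pos hpos.ne' hx).ne']

theorem integrable_of_mem_weightedC0 (hW : LowerSemicontinuous W) (hpos : ∀ x, 0 < W x)
    {μ : Measure ℝ} (hμ : ∫⁻ x, W x ∂μ ≠ ⊤) (f : weightedC0 W) : Integrable f.1 μ := by
  obtain ⟨C, hC⟩ := exists_forall_abs_mul_le hW hpos f
  refine ((integrable_toReal_of_lintegral_ne_top hW.measurable.aemeasurable hμ).const_mul
    C).mono' f.2.1.aestronglyMeasurable ?_
  filter_upwards [ae_ne_top_weight hW hμ] with x hx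
  rw [← mul_inv_toReal_mul_toReal (hpos x) hx (f.1 x), norm_mul,
    Real.norm_of_nonneg (ENNReal.toReal_nonneg (a := W x))]
  exact mul_le_mul_of_nonneg_right (hC x) ENNReal.toReal_nonneg

/-- Compactly supported functions are dense in `C₀(W)`. -/
theorem exists_seq_hasCompactSupport (f : weightedC0 W) :
    ∃ F : ℕ → weightedC0 W, (∀ n, HasCompactSupport (F n).1) ∧ (∀ n x, |(F n).1 x| ≤ |f.1 x|) ∧
      (∀ x, Tendsto (fun n ↦ (F n).1 x) atTop (nhds (f.1 x))) ∧
      ∀ ε > 0, ∀ᶠ n in atTop, ∀ x, |(f.1 x - (F n).1 x) * (W x)⁻¹.toReal| ≤ ε := by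
  have hsupp : ∀ n, HasCompactSupport fun x ↦ f.1 x * cutoff n x := fun n ↦
    (hasCompactSupport_cutoff n).mul_left
  refine ⟨fun n ↦ ⟨fun x ↦ f.1 x * cutoff n x,
    (hsupp n).mem_weightedC0 (f.2.1.mul (continuous_cutoff n))⟩, hsupp, fun n x ↦ ?_, fun x ↦ ?_,
    fun ε hε ↦ ?_⟩
  · rw [abs_mul, abs_of_nonneg (cutoff_nonneg n x)]
    exact mul_le_of_le_one_right (abs_nonneg _) (cutoff_le_one n x)
  · refine tendsto_const_nhds.congr' ?_
    obtain ⟨N, hN⟩ := exists_nat_ge (|x| + 1)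
    filter_upwards [eventually_ge_atTop N] with n hn
    have hn' : (N : ℝ) ≤ n := by exact_mod_cast hn
    simp [cutoff_eq_one (hN.trans hn')]
  · have h1 : ∀ᶠ x in cocompact ℝ, |f.1 x * (W x)⁻¹.toReal| < ε := by
      have := f.2.2.abs
      rw [abs_zero] at this
      exact this.eventually_lt_const hε
    obtain ⟨K, hK, hKε⟩ := mem_cocompact.1 h1
    obtain ⟨R, hR⟩ := hK.isBounded.exists_norm_le
    obtain ⟨N, hN⟩ := exists_nat_ge (R + 1)
    filter_upwards [eventually_ge_atTop N] with n hn x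
    have hn' : (N : ℝ) ≤ n := by exact_mod_cast hn
    change |(f.1 x - f.1 x * cutoff n x) * (W x)⁻¹.toReal| ≤ ε
    by_cases hx : x ∈ K
    · have := hR x hx
      rw [Real.norm_eq_abs] at this
      rw [cutoff_eq_one (by linarith)]
      simpa using hε.le
    · have h2 : |f.1 x * (W x)⁻¹.toReal| < ε := hKε hx
      rw [show (f.1 x - f.1 x * cutoff n x) * (W x)⁻¹.toReal =
        (f.1 x * (W x)⁻¹.toReal) * (1 - cutoff n x) by ring, abs_mul,
        abs_of_nonneg (sub_nonneg.2 (cutoff_le_one n x))]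
      exact (mul_le_of_le_one_right (abs_nonneg _) (by linarith [cutoff_nonneg n x])).trans h2.le

/-- The Riesz–Markov–Kakutani theorem for positive functionals on `C₀(W)`, restricted to compactly
supported functions. -/
theorem exists_measure_of_nonneg (Λ : weightedC0 W →ₗ[ℝ] ℝ)
    (hΛ : ∀ f : weightedC0 W, (∀ x, 0 ≤ f.1 x) → 0 ≤ Λ f) :
    ∃ μ : Measure ℝ, IsFiniteMeasureOnCompacts μ ∧
      ∀ f : weightedC0 W, HasCompactSupport f.1 → Λ f = ∫ x, f.1 x ∂μ := by
  let ι : CompactlySupportedContinuousMap ℝ ℝ →ₗ[ℝ] weightedC0 W :=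
    { toFun := fun f ↦ ⟨f, f.hasCompactSupport.mem_weightedC0 f.continuous⟩
      map_add' := fun f g ↦ rfl
      map_smul' := fun c f ↦ rfl }
  let Λ' : CompactlySupportedContinuousMap ℝ ℝ →ₚ[ℝ] ℝ :=
    PositiveLinearMap.mk₀ (Λ ∘ₗ ι) fun f hf ↦ hΛ (ι f) fun x ↦ hf x
  refine ⟨RealRMK.rieszMeasure Λ', inferInstance, fun f hf ↦ ?_⟩
  exact (RealRMK.integral_rieszMeasure Λ' ⟨⟨f.1, f.2.1⟩, hf⟩).symm

/-- Integral representation of the functionals on pairs dominated by `pairSup`. -/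
theorem exists_measures_of_le_pairSup (hW : LowerSemicontinuous W) (hpos : ∀ x, 0 < W x)
    (Φ : weightedC0 W × weightedC0 W →ₗ[ℝ] ℝ) (hΦ : ∀ F, Φ F ≤ pairSup F) :
    ∃ μ ν : Measure ℝ, IsFiniteMeasureOnCompacts μ ∧ IsFiniteMeasureOnCompacts ν ∧
      ∫⁻ x, W x ∂(μ + ν) ≤ 1 ∧ ∀ F, Φ F = ∫ x, F.1.1 x ∂μ + ∫ x, F.2.1 x ∂ν := by
  have hΦ0 : ∀ F : weightedC0 W × weightedC0 W, (∀ x, 0 ≤ F.1.1 x) → (∀ x, 0 ≤ F.2.1 x) →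
      0 ≤ Φ F := fun F h1 h2 ↦ by
    have h : Φ (-F) ≤ 0 := (hΦ _).trans (pairSup_le le_rfl
      (fun x ↦ mul_nonpos_of_nonpos_of_nonneg (neg_nonpos.2 (h1 x)) ENNReal.toReal_nonneg)
      (fun x ↦ mul_nonpos_of_nonpos_of_nonneg (neg_nonpos.2 (h2 x)) ENNReal.toReal_nonneg))
    rw [map_neg] at h
    linarith
  obtain ⟨μ, hμ, hμΦ⟩ := exists_measure_of_nonneg (Φ ∘ₗ LinearMap.inl ℝ _ _)
    fun f hf ↦ hΦ0 (f, 0) hf fun x ↦ le_rfl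
  obtain ⟨ν, hν, hνΦ⟩ := exists_measure_of_nonneg (Φ ∘ₗ LinearMap.inr ℝ _ _)
    fun f hf ↦ hΦ0 (0, f) (fun x ↦ le_rfl) hf
  have hsplit : ∀ F, Φ F = Φ (F.1, 0) + Φ (0, F.2) := fun F ↦ by
    rw [← map_add]; simp
  have hWle : ∫⁻ x, W x ∂(μ + ν) ≤ 1 := by
    obtain ⟨f, hfc, hfs, hf0, hfm, hfW⟩ := hW.exists_monotone_seq_hasCompactSupport
    have hlim : ∫⁻ x, W x ∂(μ + ν) = ⨆ n, ∫⁻ x, ENNReal.ofReal (f n x) ∂(μ + ν) := by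
      rw [← lintegral_iSup (fun n ↦ (hfc n).measurable.ennreal_ofReal)
        fun m n hmn x ↦ ENNReal.ofReal_le_ofReal (hfm x hmn)]
      exact lintegral_congr fun x ↦ (hfW x).symm
    rw [hlim]
    refine iSup_le fun n ↦ ?_
    let g : weightedC0 W := ⟨f n, (hfs n).mem_weightedC0 (hfc n)⟩
    have hi1 : Integrable (f n) μ := (hfc n).integrable_of_hasCompactSupport (hfs n)
    have hi2 : Integrable (f n) ν := (hfc n).integrable_of_hasCompactSupport (hfs n)
    rw [← ofReal_integral_eq_lintegral_ofReal (hi1.add_measure hi2)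
      (ae_of_all _ (hf0 n)), integral_add_measure hi1 hi2]
    have h1 : Φ (g, g) = ∫ x, f n x ∂μ + ∫ x, f n x ∂ν := by
      rw [hsplit]
      exact congrArg₂ (· + ·) (hμΦ g (hfs n)) (hνΦ g (hfs n))
    have h2 : ∀ x, f n x * (W x)⁻¹.toReal ≤ 1 := fun x ↦ by
      by_cases hx : W x = ⊤
      · simp [hx]
      · have h3 : f n x ≤ (W x).toReal := (ENNReal.ofReal_le_iff_le_toReal hx).1
          ((le_iSup (fun n ↦ ENNReal.ofReal (f n x)) n).trans (hfW x).le)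
        rw [ENNReal.toReal_inv, ← div_eq_mul_inv]
        exact div_le_one_of_le₀ h3 ENNReal.toReal_nonneg
    rw [← h1, ← ENNReal.ofReal_one]
    exact ENNReal.ofReal_le_ofReal ((hΦ _).trans (pairSup_le zero_le_one h2 h2))
  have hWtop : ∫⁻ x, W x ∂(μ + ν) ≠ ⊤ := ne_top_of_le_ne_top ENNReal.one_ne_top hWle
  rw [lintegral_add_measure, ENNReal.add_ne_top] at hWtop
  have aux : ∀ (ρ : Measure ℝ) (Λ : weightedC0 W →ₗ[ℝ] ℝ), ∫⁻ x, W x ∂ρ ≠ ⊤ →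
      (∀ f, HasCompactSupport f.1 → Λ f = ∫ x, f.1 x ∂ρ) →
      (∀ f C, 0 ≤ C → (∀ x, |f.1 x * (W x)⁻¹.toReal| ≤ C) → Λ f ≤ C) →
      ∀ f, Λ f = ∫ x, f.1 x ∂ρ := fun ρ Λ hρ hΛρ hΛ f ↦ by
    obtain ⟨F, hFs, hFle, hFlim, hFsup⟩ := exists_seq_hasCompactSupport f
    have h1 : Tendsto (fun n ↦ Λ (F n)) atTop (nhds (Λ f)) := by
      refine Metric.tendsto_nhds.2 fun ε hε ↦ ?_
      filter_upwards [hFsup (ε / 2) (half_pos hε)] with n hn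
      have h2 := hΛ (f - F n) (ε / 2) (half_pos hε).le hn
      have h3 := hΛ (-(f - F n)) (ε / 2) (half_pos hε).le fun x ↦ by
        refine le_of_eq_of_le ?_ (hn x)
        rw [← abs_neg, ← neg_mul]
        exact congrArg (fun t ↦ |t * _|) (neg_neg _)
      rw [map_neg, map_sub] at h3
      rw [map_sub] at h2
      rw [Real.dist_eq, abs_lt]
      constructor <;> linarith
    have h2 : Tendsto (fun n ↦ ∫ x, (F n).1 x ∂ρ) atTop (nhds (∫ x, f.1 x ∂ρ)) :=
      tendsto_integral_of_dominated_convergence (fun x ↦ |f.1 x|)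
        (fun n ↦ (F n).2.1.aestronglyMeasurable)
        (integrable_of_mem_weightedC0 hW hpos hρ f).abs
        (fun n ↦ ae_of_all _ (hFle n)) (ae_of_all _ hFlim)
    exact tendsto_nhds_unique h1 (h2.congr fun n ↦ (hΛρ _ (hFs n)).symm)
  refine ⟨μ, ν, hμ, hν, hWle, fun F ↦ ?_⟩
  rw [hsplit]
  refine congrArg₂ (· + ·)
    (aux μ (Φ ∘ₗ LinearMap.inl ℝ _ _) hWtop.1 hμΦ (fun f C hC hf ↦ ?_) F.1)
    (aux ν (Φ ∘ₗ LinearMap.inr ℝ _ _) hWtop.2 hνΦ (fun f C hC hf ↦ ?_) F.2)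
  · exact (hΦ (f, 0)).trans (pairSup_le hC (fun x ↦ (le_abs_self _).trans (hf x))
      fun x ↦ by simpa using hC)
  · exact (hΦ (0, f)).trans (pairSup_le hC (fun x ↦ by simpa using hC)
      fun x ↦ (le_abs_self _).trans (hf x))

theorem integral_mul_le_of_mul_le (hW : LowerSemicontinuous W) (hpos : ∀ x, 0 < W x)
    {μ : Measure ℝ} (hμ : ∫⁻ x, W x ∂μ ≠ ⊤) {f : weightedC0 W} {P : ℝ}
    (hP : ∀ x, f.1 x * (W x)⁻¹.toReal ≤ P) {k : ℝ → ℝ} (hk : AEStronglyMeasurable k μ) {C : ℝ}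
    (hkC : ∀ᵐ x ∂μ, ‖k x‖ ≤ C) (hk0 : ∀ᵐ x ∂μ, 0 ≤ k x) :
    ∫ x, f.1 x * k x ∂μ ≤ P * ∫ x, (W x).toReal * k x ∂μ := by
  rw [← integral_const_mul]
  refine integral_mono_ae ((integrable_of_mem_weightedC0 hW hpos hμ f).mul_bdd hk hkC)
    (((integrable_toReal_of_lintegral_ne_top hW.measurable.aemeasurable hμ).mul_bdd
      hk hkC).const_mul P) ?_
  filter_upwards [ae_ne_top_weight hW hμ, hk0] with x hx hkx
  have h : f.1 x ≤ P * (W x).toReal := by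
    rw [← mul_inv_toReal_mul_toReal (hpos x) hx (f.1 x)]
    exact mul_le_mul_of_nonneg_right (hP x) ENNReal.toReal_nonneg
  rw [← mul_assoc]
  exact mul_le_mul_of_nonneg_right h hkx

theorem ae_eq_zero_of_forall_integral_mul_eq_zero {μ : Measure ℝ} [IsFiniteMeasureOnCompacts μ]
    {k : ℝ → ℝ} (hk : AEStronglyMeasurable k μ) {C : ℝ} (hkC : ∀ᵐ x ∂μ, ‖k x‖ ≤ C)
    (h : ∀ f : weightedC0 W, ∫ x, f.1 x * k x ∂μ = 0) : ∀ᵐ x ∂μ, k x = 0 :=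
  ae_eq_zero_of_integral_contDiff_smul_eq_zero
    ((locallyIntegrable_const C).mono hk (hkC.mono fun _ hx ↦ hx.trans (le_abs_self C)))
    fun g hg hgs ↦ h ⟨g, hgs.mem_weightedC0 hg.continuous⟩

theorem integral_add_mul_integral_le (hW : LowerSemicontinuous W) (hpos : ∀ x, 0 < W x)
    {μ : Measure ℝ} (hμ : ∫⁻ x, W x ∂μ ≠ ⊤) {f : weightedC0 W} {P : ℝ}
    (hP : ∀ x, f.1 x * (W x)⁻¹.toReal ≤ P) {k : ℝ → ℝ} (hk : Measurable k) {D : ℝ}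
    (hkD : ∀ᵐ x ∂μ, ‖k x‖ ≤ D) {s : ℝ} (hs : |s| * D ≤ 1) :
    ∫ x, f.1 x ∂μ + s * ∫ x, f.1 x * k x ∂μ ≤
      P * (∫ x, (W x).toReal ∂μ + s * ∫ x, (W x).toReal * k x ∂μ) := by
  have hif := integrable_of_mem_weightedC0 hW hpos hμ f
  have hiV := integrable_toReal_of_lintegral_ne_top hW.measurable.aemeasurable hμ
  have hsk : ∀ᵐ x ∂μ, |s * k x| ≤ 1 := hkD.mono fun x hx ↦ by
    rw [abs_mul]
    exact (mul_le_mul_of_nonneg_left hx (abs_nonneg s)).trans hs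
  have h := integral_mul_le_of_mul_le (k := fun x ↦ 1 + s * k x) (C := 2) hW hpos hμ hP
    (measurable_const.add (hk.const_mul s)).aestronglyMeasurable
    (hsk.mono fun x hx ↦ by
      rw [Real.norm_eq_abs, abs_le]
      constructor <;> linarith [abs_le.1 hx])
    (hsk.mono fun x hx ↦ by linarith [abs_le.1 hx])
  have hexp : ∀ u : ℝ → ℝ, Integrable u μ →
      ∫ x, u x * (1 + s * k x) ∂μ = ∫ x, u x ∂μ + s * ∫ x, u x * k x ∂μ := fun u hu ↦ by
    rw [← integral_const_mul, ← integral_add hu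
      ((hu.mul_bdd hk.aestronglyMeasurable hkD).const_mul s)]
    exact integral_congr_ae (ae_of_all _ fun x ↦ by simp only; ring)
  rwa [hexp _ hif, hexp _ hiV] at h

/-- The functional on pairs induced by two measures with densities. -/
noncomputable def pairIntegral (μ ν : Measure ℝ) (k l : ℝ → ℝ)
    (hμ : ∀ f : weightedC0 W, Integrable (fun x ↦ f.1 x * k x) μ)
    (hν : ∀ f : weightedC0 W, Integrable (fun x ↦ f.1 x * l x) ν) :
    weightedC0 W × weightedC0 W →ₗ[ℝ] ℝ where
  toFun F := ∫ x, F.1.1 x * k x ∂μ + ∫ x, F.2.1 x * l x ∂ν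
  map_add' F G := by
    have h1 : ∀ x, (F + G).1.1 x * k x = F.1.1 x * k x + G.1.1 x * k x := fun x ↦ add_mul _ _ _
    have h2 : ∀ x, (F + G).2.1 x * l x = F.2.1 x * l x + G.2.1 x * l x := fun x ↦ add_mul _ _ _
    simp only [h1, h2]
    rw [integral_add (hμ _) (hμ _), integral_add (hν _) (hν _)]
    ring
  map_smul' c F := by
    have h1 : ∀ x, (c • F).1.1 x * k x = c * (F.1.1 x * k x) := fun x ↦ mul_assoc _ _ _
    have h2 : ∀ x, (c • F).2.1 x * l x = c * (F.2.1 x * l x) := fun x ↦ mul_assoc _ _ _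
    simp only [h1, h2, integral_const_mul, RingHom.id_apply, smul_eq_mul]
    ring

/-- The extreme functional on pairs which annihilates `{(f, -f) | f ∈ L}`. -/
theorem exists_extreme_pair_functional (hW : LowerSemicontinuous W) (hpos : ∀ x, 0 < W x)
    (L : Submodule ℝ (weightedC0 W)) {f₀ : weightedC0 W} {δ : ℝ} (hδ : 0 < δ)
    (hf₀ : ∀ g ∈ L, ¬ ∀ x, |(f₀.1 x - g.1 x) * (W x)⁻¹.toReal| ≤ δ) :
    ∃ Φ : weightedC0 W × weightedC0 W →ₗ[ℝ] ℝ, (∀ F, Φ F ≤ pairSup F) ∧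
      (∀ f ∈ L, Φ (f, -f) = 0) ∧ 0 < Φ (f₀, -f₀) ∧
      ∀ Ψ : weightedC0 W × weightedC0 W →ₗ[ℝ] ℝ, (∀ F, Φ F + Ψ F ≤ pairSup F) →
        (∀ F, Φ F - Ψ F ≤ pairSup F) → (∀ f ∈ L, Ψ (f, -f) = 0) → Ψ = 0 := by
  let M : Submodule ℝ (weightedC0 W × weightedC0 W) :=
    L.map (LinearMap.id.prod (-LinearMap.id))
  have hM : ∀ f ∈ L, (f, -f) ∈ M := fun f hf ↦ ⟨f, hf, rfl⟩
  have hdist : ∀ m ∈ M, δ ≤ pairSup ((f₀, -f₀) + m) := by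
    rintro _ ⟨g, hg, rfl⟩
    by_contra! hlt
    refine hf₀ (-g) (L.neg_mem hg) fun x ↦ abs_le'.2 ⟨?_, ?_⟩
    · refine le_trans (le_of_eq ?_) ((fst_mul_le_pairSup hW hpos _ x).trans hlt.le)
      exact congrArg (· * _) (sub_neg_eq_add _ _)
    · refine le_trans (le_of_eq ?_) ((snd_mul_le_pairSup hW hpos _ x).trans hlt.le)
      change -((f₀.1 x - -g.1 x) * _) = (-f₀.1 x + -g.1 x) * _
      ring
  obtain ⟨Φ, hΦle, hΦM, hΦ0, hΦext⟩ := exists_extreme_dominated_functional pairSup_nonneg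
    (fun c hc ↦ pairSup_smul hc) (pairSup_add_le hW hpos) M hδ hdist
  refine ⟨Φ, hΦle, fun f hf ↦ hΦM _ (hM f hf), hΦ0, fun Ψ h1 h2 h3 ↦ hΦext Ψ h1 h2 ?_⟩
  rintro _ ⟨f, hf, rfl⟩
  exact h3 f hf

/-- An extreme pair of positive measures whose difference annihilates a non-dense subspace: the
only pairs of bounded densities preserving the annihilation are the constant ones. -/
theorem exists_extreme_pair_measure (hW : LowerSemicontinuous W) (hpos : ∀ x, 0 < W x)
    (L : Submodule ℝ (weightedC0 W)) {f₀ : weightedC0 W} {δ : ℝ} (hδ : 0 < δ)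
    (hf₀ : ∀ g ∈ L, ¬ ∀ x, |(f₀.1 x - g.1 x) * (W x)⁻¹.toReal| ≤ δ) :
    ∃ μ ν : Measure ℝ, IsFiniteMeasureOnCompacts μ ∧ IsFiniteMeasureOnCompacts ν ∧
      ∫⁻ x, W x ∂(μ + ν) ≤ 1 ∧ μ ≠ ν ∧ (∀ f ∈ L, ∫ x, f.1 x ∂μ = ∫ x, f.1 x ∂ν) ∧
      ∀ (k l : ℝ → ℝ) (C : ℝ), Measurable k → Measurable l →
        (∀ᵐ x ∂μ, ‖k x‖ ≤ C) → (∀ᵐ x ∂ν, ‖l x‖ ≤ C) →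
        (∀ f ∈ L, ∫ x, f.1 x * k x ∂μ = ∫ x, f.1 x * l x ∂ν) →
        ∃ c, (∀ᵐ x ∂μ, k x = c) ∧ ∀ᵐ x ∂ν, l x = c := by
  obtain ⟨Φ, hΦle, hΦM, hΦ0, hΦext⟩ := exists_extreme_pair_functional hW hpos L hδ hf₀
  obtain ⟨μ, ν, hμ, hν, hWle, hΦ⟩ := exists_measures_of_le_pairSup hW hpos Φ hΦle
  have hWtop : ∫⁻ x, W x ∂(μ + ν) ≠ ⊤ := ne_top_of_le_ne_top ENNReal.one_ne_top hWle
  have hWμν := hWtop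
  rw [lintegral_add_measure, ENNReal.add_ne_top] at hWμν
  obtain ⟨hWμ, hWν⟩ := hWμν
  have hVμ := integrable_toReal_of_lintegral_ne_top hW.measurable.aemeasurable hWμ
  have hVν := integrable_toReal_of_lintegral_ne_top hW.measurable.aemeasurable hWν
  have hneg : ∀ (f : weightedC0 W) (ρ : Measure ℝ), ∫ x, (-f).1 x ∂ρ = -∫ x, f.1 x ∂ρ :=
    fun f ρ ↦ integral_neg _
  refine ⟨μ, ν, hμ, hν, hWle, ?_, fun f hf ↦ ?_, fun k l C hk hl hkC hlC hkl ↦ ?_⟩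
  · rintro rfl
    rw [hΦ, hneg, add_neg_cancel] at hΦ0
    exact lt_irrefl _ hΦ0
  · have := hΦM f hf
    rw [hΦ, hneg] at this
    linarith
  set m := ∫ x, (W x).toReal ∂μ + ∫ x, (W x).toReal ∂ν with hm
  have hm1 : m ≤ 1 := by
    rw [hm, ← integral_add_measure hVμ hVν,
      integral_toReal hW.measurable.aemeasurable (ae_lt_top hW.measurable hWtop)]
    exact ENNReal.toReal_mono ENNReal.one_ne_top hWle
  have hm0 : 0 < m := by
    have h1 := integral_mul_le_of_mul_le (f := f₀) (k := fun _ ↦ 1) (C := 1) hW hpos hWμ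
      (fst_mul_le_pairSup hW hpos (f₀, -f₀)) aestronglyMeasurable_const (by simp) (by simp)
    have h2 := integral_mul_le_of_mul_le (f := -f₀) (k := fun _ ↦ 1) (C := 1) hW hpos hWν
      (snd_mul_le_pairSup hW hpos (f₀, -f₀)) aestronglyMeasurable_const (by simp) (by simp)
    simp only [mul_one] at h1 h2
    have h3 := pairSup_nonneg (f₀, -f₀)
    have h4 : 0 < pairSup (f₀, -f₀) * m := by
      rw [hm, mul_add]
      rw [hΦ] at hΦ0
      exact hΦ0.trans_le (add_le_add h1 h2)
    exact pos_of_mul_pos_right h4 h3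
  set a := (∫ x, (W x).toReal * k x ∂μ + ∫ x, (W x).toReal * l x ∂ν) / m with ha
  set D := |C| + |a| with hD
  have hD0 : 0 ≤ D := by positivity
  have hbound : ∀ {ρ : Measure ℝ} {j : ℝ → ℝ}, (∀ᵐ x ∂ρ, ‖j x‖ ≤ C) →
      ∀ᵐ x ∂ρ, ‖j x - a‖ ≤ D := fun hj ↦ hj.mono fun x hx ↦
    (norm_sub_le _ _).trans (add_le_add (hx.trans (le_abs_self C)) le_rfl)
  have hk' := hbound hkC
  have hl' := hbound hlC
  have hkm : Measurable fun x ↦ k x - a := hk.sub_const a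
  have hlm : Measurable fun x ↦ l x - a := hl.sub_const a
  have hiμ : ∀ f : weightedC0 W, Integrable (fun x ↦ f.1 x * (k x - a)) μ := fun f ↦
    (integrable_of_mem_weightedC0 hW hpos hWμ f).mul_bdd hkm.aestronglyMeasurable hk'
  have hiν : ∀ f : weightedC0 W, Integrable (fun x ↦ f.1 x * (l x - a)) ν := fun f ↦
    (integrable_of_mem_weightedC0 hW hpos hWν f).mul_bdd hlm.aestronglyMeasurable hl'
  have hcent : ∫ x, (W x).toReal * (k x - a) ∂μ + ∫ x, (W x).toReal * (l x - a) ∂ν = 0 := by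
    simp only [mul_sub]
    rw [integral_sub (hVμ.mul_bdd hk.aestronglyMeasurable hkC) (hVμ.mul_const a),
      integral_sub (hVν.mul_bdd hl.aestronglyMeasurable hlC) (hVν.mul_const a),
      integral_mul_const, integral_mul_const]
    have : a * m = ∫ x, (W x).toReal * k x ∂μ + ∫ x, (W x).toReal * l x ∂ν :=
      div_mul_cancel₀ _ hm0.ne'
    rw [hm] at this
    linarith
  let A := pairIntegral μ ν (fun x ↦ k x - a) (fun x ↦ l x - a) hiμ hiν
  have hle : ∀ s : ℝ, |s| * D ≤ 1 → ∀ F, Φ F + s * A F ≤ pairSup F := fun s hs F ↦ by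
    have h1 := integral_add_mul_integral_le hW hpos hWμ (fst_mul_le_pairSup hW hpos F) hkm hk' hs
    have h2 := integral_add_mul_integral_le hW hpos hWν (snd_mul_le_pairSup hW hpos F) hlm hl' hs
    have h3 : Φ F + s * A F ≤ pairSup F * m := by
      rw [hΦ]
      change _ + s * (_ + _) ≤ _
      calc _ = _ := by ring
        _ ≤ _ := add_le_add h1 h2
        _ = pairSup F * (m + s * (∫ x, (W x).toReal * (k x - a) ∂μ +
            ∫ x, (W x).toReal * (l x - a) ∂ν)) := by ring
        _ = _ := by rw [hcent, mul_zero, add_zero]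
    exact h3.trans (mul_le_of_le_one_right (pairSup_nonneg F) hm1)
  set t := (D + 1)⁻¹ with ht
  have ht0 : 0 < t := by positivity
  have htD : |t| * D ≤ 1 := by
    rw [abs_of_pos ht0, ht, inv_mul_le_iff₀ (by positivity)]
    linarith
  have hzero := hΦext (t • A) (hle t htD)
    (fun F ↦ by
      have := hle (-t) (by rwa [abs_neg]) F
      rw [neg_mul, ← sub_eq_add_neg] at this
      exact this)
    (by
      intro f hf
      have h1 : ∫ x, (-f).1 x * (l x - a) ∂ν = -∫ x, f.1 x * (l x - a) ∂ν := by
        rw [← integral_neg]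
        exact integral_congr_ae (ae_of_all _ fun x ↦ neg_mul _ _)
      change t * (∫ x, f.1 x * (k x - a) ∂μ + ∫ x, (-f).1 x * (l x - a) ∂ν) = 0
      have hfμ := integrable_of_mem_weightedC0 hW hpos hWμ f
      have hfν := integrable_of_mem_weightedC0 hW hpos hWν f
      have h2 : ∫ x, f.1 x ∂μ = ∫ x, f.1 x ∂ν := by
        have := hΦM f hf
        rw [hΦ, hneg] at this
        linarith
      rw [h1]
      simp only [mul_sub]
      rw [integral_sub (hfμ.mul_bdd hk.aestronglyMeasurable hkC) (hfμ.mul_const a),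
        integral_sub (hfν.mul_bdd hl.aestronglyMeasurable hlC) (hfν.mul_const a),
        integral_mul_const, integral_mul_const, hkl f hf, h2]
      ring)
  have hA : ∀ F, A F = 0 := fun F ↦ by
    have : t * A F = 0 := LinearMap.congr_fun hzero F
    exact (mul_eq_zero.1 this).resolve_left ht0.ne'
  refine ⟨a, ?_, ?_⟩
  · filter_upwards [ae_eq_zero_of_forall_integral_mul_eq_zero (W := W) hkm.aestronglyMeasurable hk'
      fun f ↦ by
        have : _ + ∫ x, (0 : ℝ) * (l x - a) ∂ν = 0 := hA (f, 0)
        simpa using this] with x hx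
    exact sub_eq_zero.1 hx
  · filter_upwards [ae_eq_zero_of_forall_integral_mul_eq_zero (W := W) hlm.aestronglyMeasurable hl'
      fun f ↦ by
        have : ∫ x, (0 : ℝ) * (k x - a) ∂μ + _ = 0 := hA (0, f)
        simpa using this] with x hx
    exact sub_eq_zero.1 hx

/-- Real form of de Branges' lemma. -/
theorem exists_measure_real_annihilator_eq_span (hW : LowerSemicontinuous W)
    (hpos : ∀ x, 0 < W x) (L : Submodule ℝ (weightedC0 W)) {f₀ : weightedC0 W} {δ : ℝ}
    (hδ : 0 < δ) (hf₀ : ∀ g ∈ L, ¬ ∀ x, |(f₀.1 x - g.1 x) * (W x)⁻¹.toReal| ≤ δ) :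
    ∃ ρ : Measure ℝ, IsLocallyFiniteMeasure ρ ∧ ρ ≠ 0 ∧ ∫⁻ x, W x ∂ρ < ⊤ ∧
      ∃ h : ℝ → ℝ, Measurable h ∧ (∀ᵐ x ∂ρ, |h x| = 1) ∧
        (∀ f ∈ L, ∫ x, f.1 x * h x ∂ρ = 0) ∧
        ∀ (g : ℝ → ℝ) (C : ℝ), Measurable g → (∀ᵐ x ∂ρ, ‖g x‖ ≤ C) →
          (∀ f ∈ L, ∫ x, f.1 x * g x ∂ρ = 0) → ∃ c, ∀ᵐ x ∂ρ, g x = c * h x := by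
  obtain ⟨μ, ν, hμ, hν, hWle, hne, hL, hconst⟩ :=
    exists_extreme_pair_measure hW hpos L hδ hf₀
  have hWtop : ∫⁻ x, W x ∂(μ + ν) < ⊤ := hWle.trans_lt ENNReal.one_lt_top
  have hlf : IsLocallyFiniteMeasure (μ + ν) := by
    have : IsFiniteMeasureOnCompacts (μ + ν) := ⟨fun K hK ↦ by
      rw [Measure.add_apply]
      exact ENNReal.add_lt_top.2 ⟨hK.measure_lt_top, hK.measure_lt_top⟩⟩
    infer_instance
  have hμρ : μ ≪ μ + ν := Measure.AbsolutelyContinuous.rfl.add_right ν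
  have hνρ : ν ≪ μ + ν := by
    rw [add_comm]; exact Measure.AbsolutelyContinuous.rfl.add_right μ
  set ρ := μ + ν with hρ
  set p := μ.rnDeriv ρ with hp
  set q := ν.rnDeriv ρ with hq
  have hpm : Measurable p := Measure.measurable_rnDeriv _ _
  have hqm : Measurable q := Measure.measurable_rnDeriv _ _
  have hμp : ρ.withDensity p = μ := Measure.withDensity_rnDeriv_eq _ _ hμρ
  have hνq : ρ.withDensity q = ν := Measure.withDensity_rnDeriv_eq _ _ hνρ
  have hpq : ∀ᵐ x ∂ρ, p x + q x = 1 := by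
    filter_upwards [Measure.rnDeriv_add' μ ν ρ, Measure.rnDeriv_self ρ] with x h1 h2
    rw [← hρ, h2] at h1
    exact h1.symm
  have hfin : ∀ᵐ x ∂ρ, p x ≠ ⊤ ∧ q x ≠ ⊤ ∧ (p x).toReal + (q x).toReal = 1 := by
    filter_upwards [hpq] with x hx
    have h := ENNReal.add_ne_top.1 (hx.trans_ne ENNReal.one_ne_top)
    exact ⟨h.1, h.2, by rw [← ENNReal.toReal_add h.1 h.2, hx, ENNReal.toReal_one]⟩
  have hle1 : ∀ᵐ x ∂ρ, ‖(p x).toReal‖ ≤ 1 ∧ ‖(q x).toReal‖ ≤ 1 := by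
    filter_upwards [hfin] with x hx
    have h1 : 0 ≤ (p x).toReal := ENNReal.toReal_nonneg
    have h2 : 0 ≤ (q x).toReal := ENNReal.toReal_nonneg
    rw [Real.norm_of_nonneg h1, Real.norm_of_nonneg h2]
    constructor <;> linarith [hx.2.2]
  have hintμ : ∀ f : ℝ → ℝ, ∫ x, f x ∂μ = ∫ x, f x * (p x).toReal ∂ρ := fun f ↦ by
    rw [← integral_rnDeriv_smul hμρ]
    simp only [smul_eq_mul, mul_comm (f _)]
    rfl
  have hintν : ∀ f : ℝ → ℝ, ∫ x, f x ∂ν = ∫ x, f x * (q x).toReal ∂ρ := fun f ↦ by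
    rw [← integral_rnDeriv_smul hνρ]
    simp only [smul_eq_mul, mul_comm (f _)]
    rfl
  have haeμ : ∀ {s : ℝ → Prop}, (∀ᵐ x ∂μ, s x) → ∀ᵐ x ∂ρ, p x ≠ 0 → s x := fun {s} hs ↦ by
    rwa [← hμp, ae_withDensity_iff hpm] at hs
  have haeν : ∀ {s : ℝ → Prop}, (∀ᵐ x ∂ν, s x) → ∀ᵐ x ∂ρ, q x ≠ 0 → s x := fun {s} hs ↦ by
    rwa [← hνq, ae_withDensity_iff hqm] at hs
  have hdisj : ∀ᵐ x ∂ρ, p x = 0 ∨ q x = 0 := by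
    obtain ⟨c, hc1, hc2⟩ := hconst (fun x ↦ (q x).toReal) (fun x ↦ (p x).toReal) 1
      hqm.ennreal_toReal hpm.ennreal_toReal (hμρ.ae_le (hle1.mono fun _ h ↦ h.2))
      (hνρ.ae_le (hle1.mono fun _ h ↦ h.1)) fun f _ ↦ by
        rw [hintμ, hintν]
        exact integral_congr_ae (ae_of_all _ fun x ↦ mul_right_comm _ _ _)
    rcases eq_or_ne c 0 with rfl | hc
    · filter_upwards [haeμ hc1, hfin] with x h1 h2
      by_cases h : p x = 0
      · exact Or.inl h
      · exact Or.inr (((ENNReal.toReal_eq_zero_iff _).1 (h1 h)).resolve_right h2.2.1)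
    · refine absurd ?_ hne
      rw [← hμp, ← hνq]
      refine withDensity_congr_ae ?_
      filter_upwards [haeμ hc1, haeν hc2, hfin] with x h1 h2 ⟨h3, h4, h5⟩
      have hp0 : p x ≠ 0 := fun h ↦ by
        have hq0 : q x ≠ 0 := fun h' ↦ by simp [h, h'] at h5
        have := h2 hq0
        rw [h, ENNReal.toReal_zero] at this
        exact hc this.symm
      have hq0 : q x ≠ 0 := fun h ↦ by
        have := h1 hp0
        rw [h, ENNReal.toReal_zero] at this
        exact hc this.symm
      exact (ENNReal.toReal_eq_toReal_iff' h3 h4).1 ((h2 hq0).trans (h1 hp0).symm)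
  have hρtop := hWtop.ne
  refine ⟨ρ, hlf, fun h0 ↦ hne ?_, hWtop, fun x ↦ (p x).toReal - (q x).toReal,
    hpm.ennreal_toReal.sub hqm.ennreal_toReal, ?_, fun f hf ↦ ?_, fun g C hg hgC hgL ↦ ?_⟩
  · rw [← hμp, ← hνq, h0]; simp
  · filter_upwards [hdisj, hfin] with x h1 ⟨_, _, h2⟩
    rcases h1 with h | h <;> rw [h, ENNReal.toReal_zero] at h2 ⊢
    · rw [zero_add] at h2; rw [h2]; norm_num
    · rw [add_zero] at h2; rw [h2]; norm_num
  · have hfρ := integrable_of_mem_weightedC0 hW hpos hρtop f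
    simp only [mul_sub]
    rw [integral_sub (hfρ.mul_bdd hpm.ennreal_toReal.aestronglyMeasurable
        (hle1.mono fun _ h ↦ h.1)) (hfρ.mul_bdd hqm.ennreal_toReal.aestronglyMeasurable
        (hle1.mono fun _ h ↦ h.2)), ← hintμ, ← hintν, hL f hf, sub_self]
  · have hgμ := hμρ.ae_le hgC
    have hgν : ∀ᵐ x ∂ν, ‖g x‖ ≤ C := hνρ.ae_le hgC
    obtain ⟨c, hc1, hc2⟩ := hconst g (fun x ↦ -g x) C hg hg.neg hgμ
      (hgν.mono fun x hx ↦ by rwa [norm_neg]) fun f hf ↦ by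
        have hfg := (integrable_of_mem_weightedC0 hW hpos hρtop f).mul_bdd
          hg.aestronglyMeasurable hgC
        have h := hgL f hf
        rw [hρ, integral_add_measure hfg.left_of_add_measure hfg.right_of_add_measure] at h
        simp only [mul_neg, integral_neg]
        linarith
    refine ⟨c, ?_⟩
    filter_upwards [hdisj, hfin, haeμ hc1, haeν hc2] with x h1 ⟨_, _, h2⟩ h3 h4
    rcases h1 with h | h
    · have hq0 : q x ≠ 0 := fun h' ↦ by simp [h, h'] at h2
      rw [h, ENNReal.toReal_zero] at h2 ⊢
      rw [zero_add] at h2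
      rw [h2, ← h4 hq0]; ring
    · have hp0 : p x ≠ 0 := fun h' ↦ by simp [h, h'] at h2
      rw [h, ENNReal.toReal_zero] at h2 ⊢
      rw [add_zero] at h2
      rw [h2, h3 hp0]; ring

theorem enorm_div_eq_ofReal_abs (hpos : ∀ x, 0 < W x) (z : ℂ) (x : ℝ) :
    (‖z‖₊ : ℝ≥0∞) / W x = ENNReal.ofReal (‖z‖ * (W x)⁻¹.toReal) := by
  rw [ENNReal.ofReal_mul (norm_nonneg z),
    ENNReal.ofReal_toReal (ENNReal.inv_ne_top.2 (hpos x).ne'), div_eq_mul_inv,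
    ofReal_norm, enorm_eq_nnnorm]

theorem MemC0e.comp_mem_weightedC0 (hpos : ∀ x, 0 < W x) {f : ℝ → ℂ} (hf : MemC0e W f)
    {T : ℂ → ℝ} (hT : Continuous T) (hT' : ∀ z, |T z| ≤ ‖z‖) :
    (fun x ↦ T (f x)) ∈ weightedC0 W := by
  refine ⟨hT.comp hf.1, ?_⟩
  have h := (ENNReal.tendsto_toReal ENNReal.zero_ne_top).comp hf.2
  rw [ENNReal.toReal_zero] at h
  refine squeeze_zero_norm (fun x ↦ ?_) h
  rw [Function.comp_apply, enorm_div_eq_ofReal_abs hpos, ENNReal.toReal_ofReal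
    (mul_nonneg (norm_nonneg _) ENNReal.toReal_nonneg), norm_mul,
    Real.norm_of_nonneg (ENNReal.toReal_nonneg (a := (W x)⁻¹))]
  exact mul_le_mul_of_nonneg_right (hT' _) ENNReal.toReal_nonneg

/-- The real-valued functions of a complex subspace of `C₀(W)`. -/
def realFunctions (W : ℝ → ℝ≥0∞) (L : Submodule ℂ (ℝ → ℂ)) : Submodule ℝ (weightedC0 W) where
  carrier := {f | (fun x ↦ (f.1 x : ℂ)) ∈ L}
  add_mem' := fun {f g} hf hg ↦ by
    change (fun x ↦ ((f.1 x + g.1 x : ℝ) : ℂ)) ∈ L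
    convert L.add_mem hf hg using 1
    ext x; exact Complex.ofReal_add _ _
  zero_mem' := by
    change (fun _ ↦ ((0 : ℝ) : ℂ)) ∈ L
    convert L.zero_mem using 1
    ext x; exact Complex.ofReal_zero
  smul_mem' := fun c f hf ↦ by
    change (fun x ↦ ((c * f.1 x : ℝ) : ℂ)) ∈ L
    convert L.smul_mem (c : ℂ) hf using 1
    ext x; exact Complex.ofReal_mul _ _

theorem mem_realFunctions {L : Submodule ℂ (ℝ → ℂ)} {f : weightedC0 W} :
    f ∈ realFunctions W L ↔ (fun x ↦ (f.1 x : ℂ)) ∈ L := Iff.rfl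

theorem re_mem_of_conj_mem {L : Submodule ℂ (ℝ → ℂ)} {f : ℝ → ℂ} (hf : f ∈ L)
    (hconj : (fun x ↦ (starRingEnd ℂ) (f x)) ∈ L) : (fun x ↦ ((f x).re : ℂ)) ∈ L := by
  convert L.smul_mem (1 / 2 : ℂ) (L.add_mem hf hconj) using 1
  ext x
  simp only [Pi.smul_apply, Pi.add_apply, Complex.add_conj, smul_eq_mul, Complex.ofReal_mul, Complex.ofReal_ofNat]
  ring

theorem im_mem_of_conj_mem {L : Submodule ℂ (ℝ → ℂ)} {f : ℝ → ℂ} (hf : f ∈ L)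
    (hconj : (fun x ↦ (starRingEnd ℂ) (f x)) ∈ L) : (fun x ↦ ((f x).im : ℂ)) ∈ L := by
  convert L.smul_mem (-Complex.I / 2) (L.sub_mem hf hconj) using 1
  ext x
  simp only [Pi.smul_apply, Pi.sub_apply, Complex.sub_conj, smul_eq_mul, Complex.ofReal_mul,
    Complex.ofReal_ofNat]
  linear_combination ((f x).im : ℂ) * Complex.I_mul_I

end WeightedC0

/-- De Branges' lemma (weighted version): if `𝓛 ⊆ C₀(W)` is a conjugation-invariant
linear subspace whose closure is not all of `C₀(W)`, then there is a positive Borel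
measure `μ ≠ 0` with `∫ W dμ < ∞` whose `L¹(μ)`–annihilator of `𝓛` is one-dimensional,
spanned by a unimodular function `g₀ ∈ L^∞(μ)`. -/
theorem stmt9 (W : ℝ → ℝ≥0∞) (hW : IsWeight W)
    (L : Submodule ℂ (ℝ → ℂ)) (hL : ∀ f ∈ L, MemC0e W f)
    (hconj : ∀ f ∈ L, (fun x => (starRingEnd ℂ) (f x)) ∈ L)
    (hnd : ¬ ∀ f : ℝ → ℂ, MemC0e W f → ∀ ε : ℝ≥0∞, 0 < ε →
      ∃ g ∈ L, eC0norm W (fun x => f x - g x) < ε) :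
    ∃ μ : Measure ℝ, IsLocallyFiniteMeasure μ ∧ μ ≠ 0 ∧
      -- (i)
      (∫⁻ x, W x ∂μ) < ⊤ ∧
      -- (ii)
      ∃ g₀ : ℝ → ℂ, Measurable g₀ ∧ (∀ᵐ x ∂μ, ‖g₀ x‖ = 1) ∧
        (∀ f ∈ L, ∫ x, f x * g₀ x ∂μ = 0) ∧
        (∀ g : ℝ → ℂ, Measurable g → (∃ C : ℝ, ∀ᵐ x ∂μ, ‖g x‖ ≤ C) →
          (∀ f ∈ L, ∫ x, f x * g x ∂μ = 0) →
          ∃ c : ℂ, ∀ᵐ x ∂μ, g x = c * g₀ x) := by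
  obtain ⟨hlsc, hpos, -⟩ := hW
  have hre : ∀ z : ℂ, |z.re| ≤ ‖z‖ := Complex.abs_re_le_norm
  have him : ∀ z : ℂ, |z.im| ≤ ‖z‖ := Complex.abs_im_le_norm
  obtain ⟨f₀, δ, hδ, hf₀⟩ : ∃ (f₀ : weightedC0 W) (δ : ℝ), 0 < δ ∧ ∀ g ∈ realFunctions W L,
      ¬ ∀ x, |(f₀.1 x - g.1 x) * (W x)⁻¹.toReal| ≤ δ := by
    by_contra! happ
    refine hnd fun f hf ε hε ↦ ?_
    obtain ⟨η, hη, hηε⟩ := ENNReal.lt_iff_exists_nnreal_btwn.1 hε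
    have hη0 : 0 < (η : ℝ) := by exact_mod_cast hη
    obtain ⟨u, hu, hu'⟩ := happ ⟨_, hf.comp_mem_weightedC0 hpos Complex.continuous_re hre⟩
      (η / 2) (half_pos hη0)
    obtain ⟨v, hv, hv'⟩ := happ ⟨_, hf.comp_mem_weightedC0 hpos Complex.continuous_im him⟩
      (η / 2) (half_pos hη0)
    refine ⟨_, L.add_mem (mem_realFunctions.1 hu) (L.smul_mem Complex.I (mem_realFunctions.1 hv)),
      lt_of_le_of_lt (iSup_le fun x ↦ ?_) hηε⟩
    rw [enorm_div_eq_ofReal_abs hpos, ← ENNReal.ofReal_coe_nnreal]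
    refine ENNReal.ofReal_le_ofReal ?_
    have hw : 0 ≤ (W x)⁻¹.toReal := ENNReal.toReal_nonneg
    have h1 := hu' x
    have h2 := hv' x
    rw [abs_mul, abs_of_nonneg hw] at h1 h2
    have h3 := Complex.norm_le_abs_re_add_abs_im
      (f x - ((u.1 x : ℂ) + Complex.I * (v.1 x : ℂ)))
    simp only [Complex.sub_re, Complex.add_re, Complex.mul_re, Complex.sub_im, Complex.add_im,
      Complex.mul_im, Complex.ofReal_re, Complex.ofReal_im, Complex.I_re, Complex.I_im, zero_mul,
      one_mul, mul_zero, sub_zero, add_zero, zero_add] at h3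
    calc _ ≤ (|(f x).re - u.1 x| + |(f x).im - v.1 x|) * (W x)⁻¹.toReal :=
          mul_le_mul_of_nonneg_right h3 hw
      _ ≤ η := by rw [add_mul]; linarith
  obtain ⟨ρ, hlf, hρ0, hWρ, h, hhm, hh1, hhL, hspan⟩ :=
    exists_measure_real_annihilator_eq_span hlsc hpos (realFunctions W L) hδ hf₀
  have hint : ∀ f ∈ L, Integrable f ρ := fun f hf ↦ by
    have h1 := integrable_of_mem_weightedC0 hlsc hpos hWρ.ne
      ⟨_, (hL f hf).comp_mem_weightedC0 hpos continuous_norm fun z ↦ (abs_norm z).le⟩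
    exact (integrable_norm_iff (hL f hf).1.aestronglyMeasurable).1 h1
  refine ⟨ρ, hlf, hρ0, hWρ, fun x ↦ (h x : ℂ), Complex.measurable_ofReal.comp hhm, ?_,
    fun f hf ↦ ?_, ?_⟩
  · filter_upwards [hh1] with x hx
    rw [Complex.norm_real, Real.norm_eq_abs, hx]
  · have hfh : Integrable (fun x ↦ f x * (h x : ℂ)) ρ := (hint f hf).mul_bdd (c := 1)
      (Complex.measurable_ofReal.comp hhm).aestronglyMeasurable
      (hh1.mono fun x hx ↦ by
        rw [Complex.norm_real, Real.norm_eq_abs, hx])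
    have h1 := hhL ⟨_, (hL f hf).comp_mem_weightedC0 hpos Complex.continuous_re hre⟩
      (mem_realFunctions.2 (re_mem_of_conj_mem hf (hconj f hf)))
    have h2 := hhL ⟨_, (hL f hf).comp_mem_weightedC0 hpos Complex.continuous_im him⟩
      (mem_realFunctions.2 (im_mem_of_conj_mem hf (hconj f hf)))
    refine Complex.ext ?_ ?_
    · rw [← RCLike.re_eq_complex_re, ← integral_re hfh]
      simpa using h1
    · rw [← RCLike.im_eq_complex_im, ← integral_im hfh]
      simpa using h2
  · rintro g hgm ⟨C, hgC⟩ hgL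
    have hfg : ∀ f ∈ L, Integrable (fun x ↦ f x * g x) ρ := fun f hf ↦
      (hint f hf).mul_bdd hgm.aestronglyMeasurable hgC
    obtain ⟨c, hc⟩ := hspan (fun x ↦ (g x).re) C (Complex.measurable_re.comp hgm)
      (hgC.mono fun x hx ↦ (hre _).trans hx) fun f hf ↦ by
        have h1 := congrArg Complex.re (hgL _ (mem_realFunctions.1 hf))
        rw [← RCLike.re_eq_complex_re, ← integral_re (hfg _ (mem_realFunctions.1 hf))] at h1
        simpa using h1
    obtain ⟨d, hd⟩ := hspan (fun x ↦ (g x).im) C (Complex.measurable_im.comp hgm)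
      (hgC.mono fun x hx ↦ (him _).trans hx) fun f hf ↦ by
        have h1 := congrArg Complex.im (hgL _ (mem_realFunctions.1 hf))
        rw [← RCLike.im_eq_complex_im, ← integral_im (hfg _ (mem_realFunctions.1 hf))] at h1
        simpa using h1
    refine ⟨⟨c, d⟩, ?_⟩
    filter_upwards [hc, hd] with x hcx hdx
    refine Complex.ext ?_ ?_ <;> simp [hcx, hdx]
end

section
/- Let μ be a positive Borel measure on ℝ and let 𝓛 be an algebraic de Branges space such that ∫_ℝ |F| dμ < ∞ for all F ∈ 𝓛, and such that F ∈ 𝓛 with ∫_ℝ |F| dμ = 0 implies F = 0. Assume 𝓛 (via restriction to ℝ) is not dense in L¹(μ). Then the function 𝔪(z) := sup{|F(z)| : F ∈ 𝓛, ‖F|_ℝ‖_{L¹(μ)} ≤ 1} is finite at every z ∈ ℂ and is continuous on ℂ. -/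
open Filter MeasureTheory
open scoped ENNReal NNReal

/-- An algebraic de Branges space: a linear space of entire functions, invariant
under division of zeros and under `F ↦ F^#`. -/
def IsAlgebraicDeBranges (L : Submodule ℂ (ℂ → ℂ)) : Prop :=
  (∀ F ∈ L, Differentiable ℂ F) ∧
  (∀ F ∈ L, ∀ w : ℂ, F w = 0 → ∃ G ∈ L, ∀ z : ℂ, z ≠ w → G z = F z / (z - w)) ∧
  (∀ F ∈ L, (fun z => (starRingEnd ℂ) (F ((starRingEnd ℂ) z))) ∈ L)

/-- The norm of the point evaluation at `z`:
`𝔪(z) = sup {|F(z)| : F ∈ 𝓛, ‖F|_ℝ‖_{L¹(μ)} ≤ 1}`, with value `∞` if unbounded. -/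
noncomputable def L1Majorant (μ : Measure ℝ) (L : Submodule ℂ (ℂ → ℂ)) (z : ℂ) : ℝ≥0∞ :=
  ⨆ F : {F : ℂ → ℂ // F ∈ L ∧ (∫⁻ x : ℝ, (‖F (x : ℂ)‖₊ : ℝ≥0∞) ∂μ) ≤ 1},
    (‖F.1 z‖₊ : ℝ≥0∞)

/-- `f` belongs to the closure of (the restrictions of) `L` in `L¹(μ)`. -/
def MemClosL1 (μ : Measure ℝ) (L : Submodule ℂ (ℂ → ℂ)) (f : ℝ → ℂ) : Prop :=
  Integrable f μ ∧ ∀ ε : ℝ, 0 < ε →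
    ∃ F ∈ L, (∫⁻ x : ℝ, (‖f x - F (x : ℂ)‖₊ : ℝ≥0∞) ∂μ) < ENNReal.ofReal ε

/-- Density of (the restrictions to `ℝ` of) `L` in `L¹(μ)`. -/
def DenseL1 (μ : Measure ℝ) (L : Submodule ℂ (ℂ → ℂ)) : Prop :=
  ∀ f : ℝ → ℂ, Integrable f μ → MemClosL1 μ L f

/-- A nonvanishing holomorphic function on a disc has a holomorphic logarithm. -/
lemma exists_differentiableOn_exp_eq {B : ℂ → ℂ} {r : ℝ} (hr : 0 < r)
    (hB : DifferentiableOn ℂ B (Metric.ball 0 r)) (hne : ∀ z ∈ Metric.ball (0 : ℂ) r, B z ≠ 0) :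
    ∃ g : ℂ → ℂ, DifferentiableOn ℂ g (Metric.ball 0 r) ∧
      ∀ z ∈ Metric.ball (0 : ℂ) r, Complex.exp (g z) = B z := by
  have h0 : (0 : ℂ) ∈ Metric.ball (0 : ℂ) r := by simpa using hr
  have hd : DifferentiableOn ℂ (fun z => deriv B z / B z) (Metric.ball 0 r) :=
    (hB.deriv Metric.isOpen_ball).div hB hne
  obtain ⟨g₀, hg₀⟩ := hd.isExactOn_ball
  let g : ℂ → ℂ := fun z => g₀ z - g₀ 0 + Complex.log (B 0)
  have hg : ∀ z ∈ Metric.ball (0 : ℂ) r, HasDerivAt g (deriv B z / B z) z := fun z hz =>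
    ((hg₀ z hz).sub_const _).add_const _
  have hder : ∀ z ∈ Metric.ball (0 : ℂ) r,
      HasDerivAt (fun z => B z * Complex.exp (-g z)) 0 z := by
    intro z hz
    have hBz : HasDerivAt B (deriv B z) z :=
      (hB.differentiableAt (Metric.isOpen_ball.mem_nhds hz)).hasDerivAt
    have := hBz.mul (hg z hz).neg.cexp
    have e : deriv B z * Complex.exp (-g z) + B z * (Complex.exp (-g z) * -(deriv B z / B z))
        = 0 := by
      have := hne z hz
      field_simp
      ring
    exact e ▸ this
  refine ⟨g, fun z hz => (hg z hz).differentiableAt.differentiableWithinAt, fun z hz => ?_⟩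
  have hconst := Metric.isOpen_ball.is_const_of_deriv_eq_zero
    (convex_ball (0 : ℂ) r).isPreconnected
    (fun z hz => (hder z hz).differentiableAt.differentiableWithinAt)
    (fun z hz => (hder z hz).deriv) hz h0
  have hg0 : g 0 = Complex.log (B 0) := by simp [g]
  simp only [hg0, Complex.exp_neg, Complex.exp_log (hne 0 h0)] at hconst
  rw [mul_inv_cancel₀ (hne 0 h0), mul_inv_eq_one₀ (Complex.exp_ne_zero _)] at hconst
  exact hconst.symm

/-- Harnack's inequality for the modulus of a nonvanishing holomorphic function bounded by one. -/
lemma exp_neg_le_norm_of_ne_zero {B : ℂ → ℂ} {r M : ℝ} (hr : 0 < r) (hM : 0 < M)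
    (hB : DifferentiableOn ℂ B (Metric.ball 0 r)) (hne : ∀ z ∈ Metric.ball (0 : ℂ) r, B z ≠ 0)
    (hB1 : ∀ z ∈ Metric.ball (0 : ℂ) r, ‖B z‖ ≤ 1) (hB0 : Real.exp (-M) ≤ ‖B 0‖)
    {w : ℂ} (hw : ‖w‖ < r) :
    Real.exp (-(M * ((r + ‖w‖) / (r - ‖w‖)))) ≤ ‖B w‖ := by
  obtain ⟨g, hg, hgB⟩ := exists_differentiableOn_exp_eq hr hB hne
  have h0 : (0 : ℂ) ∈ Metric.ball (0 : ℂ) r := by simpa using hr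
  have hwb : w ∈ Metric.ball (0 : ℂ) r := by simpa using hw
  have hre0 : -M ≤ (g 0).re := by
    rw [← hgB 0 h0, Complex.norm_exp] at hB0
    exact Real.exp_le_exp.1 hB0
  have hmaps : Set.MapsTo (fun z => g z - g 0) (Metric.ball 0 r) {z | z.re ≤ M} := by
    intro z hz
    have := hB1 z hz
    rw [← hgB z hz, Complex.norm_exp, Real.exp_le_one_iff] at this
    simp only [Set.mem_ofPred_eq, Complex.sub_re]
    linarith
  have key := Complex.borelCaratheodory_zero hM (hg.sub_const (g 0)) hmaps hr hwb (by simp)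
  have hre := (abs_le.1 ((Complex.abs_re_le_norm _).trans key)).1
  rw [← hgB w hwb, Complex.norm_exp]
  refine Real.exp_le_exp.2 ?_
  have hpos : 0 < r - ‖w‖ := by linarith
  have : M * ((r + ‖w‖) / (r - ‖w‖)) = M + 2 * M * ‖w‖ / (r - ‖w‖) := by
    field_simp
    ring
  simp only [Complex.sub_re] at hre
  linarith

/-- The Schwarz–Pick inequality for a holomorphic self-map of the unit disc vanishing at `a`. -/
lemma norm_mul_le_norm_sub_of_zero {B : ℂ → ℂ} {a : ℂ} (ha : ‖a‖ < 1)
    (hB : DifferentiableOn ℂ B (Metric.ball 0 1))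
    (hB1 : ∀ z ∈ Metric.ball (0 : ℂ) 1, ‖B z‖ ≤ 1) (hBa : B a = 0)
    {z : ℂ} (hz : ‖z‖ < 1) :
    ‖B z‖ * ‖1 - (starRingEnd ℂ) a * z‖ ≤ ‖z - a‖ := by
  have hden : ∀ u : ℂ, ‖u‖ < 1 → 1 - (starRingEnd ℂ) a * u ≠ 0 := by
    intro u hu h
    have : ‖(starRingEnd ℂ) a * u‖ < 1 := by
      rw [norm_mul, RCLike.norm_conj]
      nlinarith [norm_nonneg a, norm_nonneg u]
    rw [← sub_eq_zero.1 h] at this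
    simp at this
  let ψ : ℂ → ℂ := fun u => (a - u) / (1 - (starRingEnd ℂ) a * u)
  have hψball : ∀ u : ℂ, ‖u‖ < 1 → ‖ψ u‖ < 1 := by
    intro u hu
    simp only [ψ, norm_div]
    rw [div_lt_one (norm_pos_iff.2 (hden u hu)), ← sq_lt_sq₀ (norm_nonneg _) (norm_nonneg _)]
    have e : ‖1 - (starRingEnd ℂ) a * u‖ ^ 2 - ‖a - u‖ ^ 2 = (1 - ‖a‖ ^ 2) * (1 - ‖u‖ ^ 2) := by
      simp only [Complex.sq_norm, Complex.normSq_apply, Complex.sub_re, Complex.sub_im,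
        Complex.mul_re, Complex.mul_im, Complex.conj_re, Complex.conj_im, Complex.one_re,
        Complex.one_im]
      ring
    have : 0 < (1 - ‖a‖ ^ 2) * (1 - ‖u‖ ^ 2) := by
      apply mul_pos <;> nlinarith [norm_nonneg a, norm_nonneg u]
    linarith
  have hψψ : ψ (ψ z) = z := by
    have h1 := hden z hz
    have h2 := hden _ (hψball z hz)
    simp only [ψ] at h2 ⊢
    rw [div_eq_iff h2, ← mul_right_inj' h1, mul_sub, mul_div_cancel₀ _ h1]
    have e : ∀ b : ℂ, 1 - b * z ≠ 0 → (1 - b * z) * a - (a - z) =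
        (1 - b * z) * (z * (1 - b * ((a - z) / (1 - b * z)))) := by
      intro b hb
      have := mul_div_cancel₀ (a - z) hb
      linear_combination (b * z) * this
    exact e _ h1
  have hcomp : DifferentiableOn ℂ (B ∘ ψ) (Metric.ball 0 1) := by
    refine hB.comp ?_ fun u hu => by simpa using hψball u (by simpa using hu)
    refine DifferentiableOn.div (by fun_prop) (by fun_prop) fun u hu => hden u (by simpa using hu)
  have key := Complex.norm_le_norm_of_mapsTo_ball hcomp
    (fun u hu => by simpa using hB1 _ (by simpa using hψball u (by simpa using hu)))
    (by simp [ψ, hBa]) (hψball z hz)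
  simp only [Function.comp, hψψ] at key
  rw [show ‖ψ z‖ = ‖a - z‖ / ‖1 - (starRingEnd ℂ) a * z‖ from norm_div _ _,
    le_div_iff₀ (norm_pos_iff.2 (hden z hz)), norm_sub_rev a z] at key
  exact key

/-- Dividing a Blaschke factor out of a holomorphic function bounded by one, together with a
multiple of it that is also bounded by one. -/
lemma exists_div_blaschke {B f : ℂ → ℂ} {a : ℂ} (ha : ‖a‖ < 1)
    (hB : DifferentiableOn ℂ B (Metric.ball 0 1)) (hf : DifferentiableOn ℂ f (Metric.ball 0 1))
    (hB1 : ∀ z ∈ Metric.ball (0 : ℂ) 1, ‖B z‖ ≤ 1)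
    (hfB : ∀ z ∈ Metric.ball (0 : ℂ) 1, ‖f z * B z‖ ≤ 1) (hBa : B a = 0) :
    ∃ B₁ : ℂ → ℂ, DifferentiableOn ℂ B₁ (Metric.ball 0 1) ∧
      (∀ z ∈ Metric.ball (0 : ℂ) 1, ‖B₁ z‖ ≤ 1) ∧
      (∀ z ∈ Metric.ball (0 : ℂ) 1, ‖f z * B₁ z‖ ≤ 1) ∧ ‖B 0‖ = ‖a‖ * ‖B₁ 0‖ := by
  have hab : a ∈ Metric.ball (0 : ℂ) 1 := by simpa using ha
  have hnhds : Metric.ball (0 : ℂ) 1 ∈ nhds a := Metric.isOpen_ball.mem_nhds hab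
  let B₁ : ℂ → ℂ := fun z => dslope B a z * (1 - (starRingEnd ℂ) a * z)
  have hB₁ : DifferentiableOn ℂ B₁ (Metric.ball 0 1) :=
    ((Complex.differentiableOn_dslope hnhds).2 hB).mul (by fun_prop)
  have hfac : ∀ z, B z = (z - a) * dslope B a z := fun z => by
    simpa [hBa] using (sub_smul_dslope B a z).symm
  have hbd : ∀ h : ℂ → ℂ, DifferentiableOn ℂ h (Metric.ball 0 1) →
      (∀ z ∈ Metric.ball (0 : ℂ) 1, ‖h z * B z‖ ≤ 1) →
      ∀ z ∈ Metric.ball (0 : ℂ) 1, ‖h z * B₁ z‖ ≤ 1 := by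
    intro h hh hhB
    have off : ∀ z ∈ Metric.ball (0 : ℂ) 1, z ≠ a → ‖h z * B₁ z‖ ≤ 1 := by
      intro z hz hza
      have := norm_mul_le_norm_sub_of_zero ha (hh.mul hB) hhB (by simp [hBa])
        (show ‖z‖ < 1 by simpa using hz)
      have hpos : 0 < ‖z - a‖ := norm_pos_iff.2 (sub_ne_zero.2 hza)
      simp only [Pi.mul_apply] at this
      rw [hfac z, ← norm_mul, show h z * ((z - a) * dslope B a z) * (1 - (starRingEnd ℂ) a * z)
        = (z - a) * (h z * B₁ z) by simp only [B₁]; ring, norm_mul] at this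
      exact le_of_mul_le_mul_left (by linarith) hpos
    intro z hz
    by_cases hza : z = a
    · have hcont : ContinuousAt (fun z => ‖h z * B₁ z‖) a :=
        ((hh.mul hB₁).differentiableAt hnhds).continuousAt.norm
      rw [hza]
      refine le_of_tendsto (hcont.tendsto.mono_left (nhdsWithin_le_nhds (s := {a}ᶜ))) ?_
      filter_upwards [mem_nhdsWithin_of_mem_nhds hnhds, self_mem_nhdsWithin] with u hu hua
      exact off u hu hua
    · exact off z hz hza
  refine ⟨B₁, hB₁, ?_, hbd f hf hfB, ?_⟩
  · simpa using hbd (fun _ => 1) (differentiableOn_const _) (by simpa using hB1)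
  · rw [hfac 0]
    simp [B₁]

lemma norm_le_exp_of_mul_bounded_aux {r M : ℝ} (hr : 0 < r) (hr1 : r < 1) (hM : 0 < M)
    {f : ℂ → ℂ} (hf : DifferentiableOn ℂ f (Metric.ball 0 1)) {w : ℂ} (hw : ‖w‖ < r) (n : ℕ) :
    ∀ B : ℂ → ℂ, DifferentiableOn ℂ B (Metric.ball 0 1) →
      (∀ z ∈ Metric.ball (0 : ℂ) 1, ‖B z‖ ≤ 1) →
      (∀ z ∈ Metric.ball (0 : ℂ) 1, ‖f z * B z‖ ≤ 1) →
      Real.exp (-M) ≤ ‖B 0‖ → r ^ n < ‖B 0‖ →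
      ‖f w‖ ≤ Real.exp (M * ((r + ‖w‖) / (r - ‖w‖))) := by
  induction n with
  | zero =>
    intro B _ hB1 _ _ h
    have := hB1 0 (by simp)
    simp only [pow_zero] at h
    linarith
  | succ n ih =>
    intro B hB hB1 hfB hB0 hn
    by_cases hz : ∃ a ∈ Metric.ball (0 : ℂ) r, B a = 0
    · obtain ⟨a, har, hBa⟩ := hz
      have har' : ‖a‖ < r := by simpa using har
      obtain ⟨B₁, h1, h2, h3, h4⟩ := exists_div_blaschke (har'.trans hr1) hB hf hB1 hfB hBa
      have hB₁0 := norm_nonneg (B₁ 0)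
      refine ih B₁ h1 h2 h3 (hB0.trans ?_) ?_
      · rw [h4]
        nlinarith [norm_nonneg a]
      · rw [h4, pow_succ'] at hn
        have : r * r ^ n < r * ‖B₁ 0‖ := hn.trans_le (by gcongr)
        exact lt_of_mul_lt_mul_left this hr.le
    · push Not at hz
      have hsub : Metric.ball (0 : ℂ) r ⊆ Metric.ball 0 1 := Metric.ball_subset_ball hr1.le
      have key := exp_neg_le_norm_of_ne_zero hr hM (hB.mono hsub) hz (fun z h => hB1 z (hsub h))
        hB0 hw
      have hfw := hfB w (hsub (by simpa using hw))
      rw [norm_mul] at hfw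
      rw [Real.exp_neg] at key
      have hpos := Real.exp_pos (M * ((r + ‖w‖) / (r - ‖w‖)))
      rw [inv_le_iff_one_le_mul₀ hpos] at key
      have : 0 < ‖B w‖ := norm_pos_iff.2 (hz w (by simpa using hw))
      refine le_of_mul_le_mul_right ?_ this
      linarith

/-- A holomorphic quotient of two holomorphic functions bounded by one grows at most
exponentially in the reciprocal of the distance to the boundary. -/
lemma norm_le_exp_of_mul_bounded {M : ℝ} (hM : 0 < M) {f B : ℂ → ℂ}
    (hf : DifferentiableOn ℂ f (Metric.ball 0 1)) (hB : DifferentiableOn ℂ B (Metric.ball 0 1))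
    (hB1 : ∀ z ∈ Metric.ball (0 : ℂ) 1, ‖B z‖ ≤ 1)
    (hfB : ∀ z ∈ Metric.ball (0 : ℂ) 1, ‖f z * B z‖ ≤ 1) (hB0 : Real.exp (-M) ≤ ‖B 0‖)
    {w : ℂ} (hw : ‖w‖ < 1) :
    ‖f w‖ ≤ Real.exp (4 * M / (1 - ‖w‖)) := by
  have hw0 := norm_nonneg w
  obtain ⟨n, hn⟩ := exists_pow_lt_of_lt_one ((Real.exp_pos _).trans_le hB0)
    (show (1 + ‖w‖) / 2 < 1 by linarith)
  refine (norm_le_exp_of_mul_bounded_aux (by linarith) (by linarith) hM hf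
    (show ‖w‖ < (1 + ‖w‖) / 2 by linarith) n B hB hB1 hfB hB0 hn).trans (Real.exp_le_exp.2 ?_)
  have h1 : 0 < 1 - ‖w‖ := by linarith
  have h2 : (1 + ‖w‖) / 2 - ‖w‖ = (1 - ‖w‖) / 2 := by ring
  rw [h2, mul_div_assoc', div_le_div_iff₀ (by positivity) h1]
  nlinarith [mul_pos hM h1]

/-- The version of `norm_le_exp_of_mul_bounded` for a disc of arbitrary centre and radius. -/
lemma norm_le_exp_of_mul_bounded_ball {M ρ : ℝ} (hM : 0 < M) (hρ : 0 < ρ) {c : ℂ} {f B : ℂ → ℂ}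
    (hf : DifferentiableOn ℂ f (Metric.ball c ρ)) (hB : DifferentiableOn ℂ B (Metric.ball c ρ))
    (hB1 : ∀ z ∈ Metric.ball c ρ, ‖B z‖ ≤ 1)
    (hfB : ∀ z ∈ Metric.ball c ρ, ‖f z * B z‖ ≤ 1) (hB0 : Real.exp (-M) ≤ ‖B c‖)
    {w : ℂ} (hw : ‖w - c‖ < ρ) :
    ‖f w‖ ≤ Real.exp (4 * M * ρ / (ρ - ‖w - c‖)) := by
  let T : ℂ → ℂ := fun ζ => c + ρ * ζ
  have hT : Set.MapsTo T (Metric.ball 0 1) (Metric.ball c ρ) := by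
    intro ζ hζ
    simp only [Metric.mem_ball, dist_zero_right] at hζ
    simp only [T, Metric.mem_ball, dist_eq_norm, add_sub_cancel_left, norm_mul, Complex.norm_real,
      Real.norm_eq_abs, abs_of_pos hρ]
    nlinarith
  have hTd : DifferentiableOn ℂ T (Metric.ball 0 1) := by fun_prop
  have hρ' : (ρ : ℂ) ≠ 0 := by exact_mod_cast hρ.ne'
  have hTw : T ((w - c) / ρ) = w := by
    simp only [T]
    field_simp
    ring
  have hnorm : ‖(w - c) / ρ‖ = ‖w - c‖ / ρ := by
    rw [norm_div, Complex.norm_real, Real.norm_eq_abs, abs_of_pos hρ]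
  have key := norm_le_exp_of_mul_bounded hM (hf.comp hTd hT) (hB.comp hTd hT)
    (fun z hz => hB1 _ (hT hz)) (fun z hz => hfB _ (hT hz)) (by simpa [T] using hB0)
    (w := (w - c) / ρ) (by rw [hnorm, div_lt_one hρ]; exact hw)
  simp only [Function.comp, hTw, hnorm] at key
  convert key using 2
  have : ρ - ‖w - c‖ ≠ 0 := by linarith
  have : 1 - ‖w - c‖ / ρ ≠ 0 := by
    rw [one_sub_div hρ.ne']
    exact div_ne_zero this hρ.ne'
  field_simp

lemma one_div_le_re_inv_add_inv {a : ℝ} {w : ℂ} (hd : 0 < a - |w.re|)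
    (hw : |w.re| + |w.im| ≤ a) :
    1 / (2 * (a - |w.re|)) ≤ (((a : ℂ) - w)⁻¹ + ((a : ℂ) + w)⁻¹).re := by
  have him : w.im ^ 2 ≤ (a - |w.re|) ^ 2 := by
    rw [← sq_abs w.im]
    gcongr
    linarith
  have main : ∀ t : ℝ, t = |w.re| → 1 / (2 * (a - |w.re|)) ≤
      (a - t) / ((a - t) * (a - t) + w.im * w.im) +
      (a + t) / ((a + t) * (a + t) + w.im * w.im) := by
    rintro t rfl
    have h0 := abs_nonneg w.re
    have h1 : 1 / (2 * (a - |w.re|)) ≤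
        (a - |w.re|) / ((a - |w.re|) * (a - |w.re|) + w.im * w.im) := by
      rw [div_le_div_iff₀ (by positivity)
        (add_pos_of_pos_of_nonneg (mul_pos hd hd) (mul_self_nonneg _))]
      nlinarith
    have h2 : 0 ≤ (a + |w.re|) / ((a + |w.re|) * (a + |w.re|) + w.im * w.im) := by
      apply div_nonneg
      · linarith
      · nlinarith [sq_nonneg (a + |w.re|), sq_nonneg w.im]
    linarith
  simp only [Complex.add_re, Complex.inv_re, Complex.sub_re, Complex.ofReal_re,
    Complex.normSq_apply, Complex.sub_im, Complex.add_im, Complex.ofReal_im, zero_sub, zero_add,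
    neg_mul_neg]
  rcases abs_cases w.re with ⟨h, _⟩ | ⟨h, _⟩
  · exact main w.re h.symm
  · have := main (-w.re) h.symm
    rw [sub_neg_eq_add, ← sub_eq_add_neg] at this
    linarith

/-- An entire function that is dominated by `exp (C / |Im w|)` on the boundary of the square with
vertices `±a` and `±ia` is bounded near the centre, by a constant depending only on `a`, `C`. -/
lemma norm_le_exp_of_bound_on_square {F : ℂ → ℂ} (hF : Differentiable ℂ F) {a C : ℝ} (ha : 0 < a)
    (hC : 0 < C)
    (hside : ∀ w : ℂ, |w.re| + |w.im| = a → w.im ≠ 0 → ‖F w‖ ≤ Real.exp (C / |w.im|))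
    {z : ℂ} (hz : ‖z‖ ≤ a / 2) : ‖F z‖ ≤ Real.exp (8 * C / a) := by
  obtain ⟨S, hS⟩ := (isCompact_closedBall (0 : ℂ) a).exists_bound_of_continuousOn
    hF.continuous.continuousOn
  have hS0 : 0 ≤ S := (norm_nonneg _).trans (hS 0 (by simpa using ha.le))
  obtain ⟨δ, hδ0, hδa, hδS⟩ : ∃ δ : ℝ, 0 < δ ∧ δ < a / 2 ∧ S ≤ Real.exp (C / δ) := by
    refine ⟨min (a / 4) (C / (S + 1)), by positivity, ?_, ?_⟩
    · exact (min_le_left _ _).trans_lt (by linarith)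
    · have h : S + 1 ≤ C / min (a / 4) (C / (S + 1)) := by
        rw [le_div_iff₀ (by positivity), mul_comm, ← le_div_iff₀ (by positivity)]
        exact min_le_right _ _
      have := Real.add_one_le_exp (C / min (a / 4) (C / (S + 1)))
      linarith
  let U : Set ℂ := {w | |w.re| < a - δ} ∩ {w | |w.re| + |w.im| < a}
  let K : Set ℂ := {w | |w.re| ≤ a - δ} ∩ {w | |w.re| + |w.im| ≤ a}
  have hUmem : ∀ w, w ∈ U ↔ |w.re| < a - δ ∧ |w.re| + |w.im| < a := fun w => Iff.rfl
  have hKmem : ∀ w, w ∈ K ↔ |w.re| ≤ a - δ ∧ |w.re| + |w.im| ≤ a := fun w => Iff.rfl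
  have hUo : IsOpen U := (isOpen_lt (by fun_prop) (by fun_prop)).inter
    (isOpen_lt (by fun_prop) (by fun_prop))
  have hKc : IsClosed K := (isClosed_le (by fun_prop) (by fun_prop)).inter
    (isClosed_le (by fun_prop) (by fun_prop))
  have hcl : closure U ⊆ K := closure_minimal (fun w hw => by
    rw [hKmem]
    rw [hUmem] at hw
    exact ⟨hw.1.le, hw.2.le⟩) hKc
  have hKball : ∀ w ∈ K, w ∈ Metric.closedBall (0 : ℂ) a := fun w hw => by
    simpa using (Complex.norm_le_abs_re_add_abs_im w).trans ((hKmem w).1 hw).2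
  have hKne : ∀ w ∈ K, (a : ℂ) - w ≠ 0 ∧ (a : ℂ) + w ≠ 0 := by
    intro w hw
    obtain ⟨h1, h2⟩ := abs_le.1 ((hKmem w).1 hw).1
    constructor <;> intro h <;> have := congrArg Complex.re h <;> simp at this <;> linarith
  let E : ℂ → ℂ := fun w => Complex.exp (-(2 * C : ℝ) * (((a : ℂ) - w)⁻¹ + ((a : ℂ) + w)⁻¹))
  have hE : ∀ w, ‖E w‖ = Real.exp (-(2 * C * (((a : ℂ) - w)⁻¹ + ((a : ℂ) + w)⁻¹).re)) := by
    intro w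
    simp only [E, Complex.norm_exp, ← Complex.ofReal_neg, Complex.re_ofReal_mul, neg_mul]
  have hEd : DifferentiableOn ℂ (fun w => E w * F w) (closure U) := by
    intro w hw
    obtain ⟨h1, h2⟩ := hKne w (hcl hw)
    have : DifferentiableAt ℂ E w := by
      simp only [E]
      fun_prop (disch := assumption)
    exact (this.mul (hF w)).differentiableWithinAt
  have hbd : Bornology.IsBounded U := Metric.isBounded_closedBall.subset
    fun w hw => hKball w (hcl (subset_closure hw))
  have hfr : ∀ w ∈ frontier U, ‖E w * F w‖ ≤ 1 := by
    intro w hw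
    rw [hUo.frontier_eq] at hw
    obtain ⟨hw1, hw2⟩ := (hKmem w).1 (hcl hw.1)
    have hd : 0 < a - |w.re| := by linarith
    have hFw : ‖F w‖ ≤ Real.exp (C / (a - |w.re|)) := by
      by_cases h : |w.re| + |w.im| = a
      · have him : |w.im| = a - |w.re| := by linarith
        rw [← him]
        exact hside w h (abs_pos.1 (by linarith))
      · have : |w.re| = a - δ := by
          by_contra h'
          exact hw.2 <| (hUmem w).2 ⟨lt_of_le_of_ne hw1 h', lt_of_le_of_ne hw2 h⟩
        rw [this, sub_sub_cancel]
        exact (hS w (hKball w ⟨hw1, hw2⟩)).trans hδS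
    have := one_div_le_re_inv_add_inv hd hw2
    rw [norm_mul, hE]
    calc _ ≤ Real.exp (-(C / (a - |w.re|))) * Real.exp (C / (a - |w.re|)) := by
          gcongr
          calc C / (a - |w.re|) = 2 * C * (1 / (2 * (a - |w.re|))) := by field_simp
            _ ≤ _ := by gcongr
      _ = 1 := by rw [← Real.exp_add]; simp
  have hzU : z ∈ U := by
    have h1 := Complex.abs_re_le_norm z
    refine (hUmem z).2 ⟨by linarith, ?_⟩
    have h2 : |z.re| ^ 2 + |z.im| ^ 2 ≤ (a / 2) ^ 2 := by
      have := Complex.sq_norm z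
      rw [Complex.normSq_apply] at this
      rw [sq_abs, sq_abs]
      nlinarith [norm_nonneg z]
    nlinarith [sq_nonneg (|z.re| - |z.im|), abs_nonneg z.re, abs_nonneg z.im]
  have key := Complex.norm_le_of_forall_mem_frontier_norm_le hbd hEd.diffContOnCl hfr
    (subset_closure hzU)
  rw [norm_mul, hE, Real.exp_neg, inv_mul_le_iff₀ (Real.exp_pos _), mul_one] at key
  refine key.trans (Real.exp_le_exp.2 ?_)
  have hinv : ∀ u : ℂ, a / 2 ≤ ‖u‖ → (u⁻¹).re ≤ 2 / a := fun u hu => by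
    refine (Complex.re_le_norm _).trans ?_
    rw [norm_inv, ← inv_div]
    exact inv_anti₀ (by positivity) hu
  have hna : ‖(a : ℂ)‖ = a := by simp [ha.le]
  have h1 := hinv (a - z) (by have := norm_sub_norm_le (a : ℂ) z; linarith)
  have h2 := hinv (a + z) (by
    have := norm_sub_norm_le (a : ℂ) (-z)
    rw [sub_neg_eq_add, norm_neg] at this
    linarith)
  rw [Complex.add_re]
  calc _ ≤ 2 * C * (2 / a + 2 / a) := by gcongr
    _ = 8 * C / a := by ring

section closure

variable {μ : Measure ℝ} {L : Submodule ℂ (ℂ → ℂ)}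

lemma MemClosL1.of_forall_exists {f : ℝ → ℂ} (hf : Integrable f μ)
    (h : ∀ ε : ℝ, 0 < ε → ∃ g, MemClosL1 μ L g ∧ ∫⁻ x, ‖f x - g x‖ₑ ∂μ ≤ ENNReal.ofReal ε) :
    MemClosL1 μ L f := by
  refine ⟨hf, fun ε hε => ?_⟩
  obtain ⟨g, hg, hfg⟩ := h (ε / 2) (by positivity)
  obtain ⟨F, hF, hgF⟩ := hg.2 (ε / 2) (by positivity)
  refine ⟨F, hF, ?_⟩
  calc ∫⁻ x : ℝ, ‖f x - F x‖ₑ ∂μ ≤ ∫⁻ x : ℝ, (‖f x - g x‖ₑ + ‖g x - F x‖ₑ) ∂μ := by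
        refine lintegral_mono fun x => ?_
        rw [← sub_add_sub_cancel (f x) (g x) (F x)]
        exact enorm_add_le _ _
    _ = ∫⁻ x : ℝ, ‖f x - g x‖ₑ ∂μ + ∫⁻ x : ℝ, ‖g x - F x‖ₑ ∂μ :=
        lintegral_add_left' (hf.sub hg.1).1.enorm _
    _ < ENNReal.ofReal (ε / 2) + ENNReal.ofReal (ε / 2) :=
        ENNReal.add_lt_add_of_le_of_lt (hfg.trans_lt ENNReal.ofReal_lt_top).ne hfg hgF
    _ = ENNReal.ofReal ε := by
        rw [← ENNReal.ofReal_add (by positivity) (by positivity), add_halves]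

lemma MemClosL1.add (hL : ∀ F ∈ L, Integrable (fun x : ℝ => F x) μ) {f g : ℝ → ℂ}
    (hf : MemClosL1 μ L f) (hg : MemClosL1 μ L g) :
    MemClosL1 μ L (fun x => f x + g x) := by
  refine ⟨hf.1.add hg.1, fun ε hε => ?_⟩
  obtain ⟨F, hF, hfF⟩ := hf.2 (ε / 2) (by positivity)
  obtain ⟨G, hG, hgG⟩ := hg.2 (ε / 2) (by positivity)
  refine ⟨F + G, L.add_mem hF hG, ?_⟩
  calc ∫⁻ x : ℝ, ‖f x + g x - (F + G) x‖ₑ ∂μ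
      ≤ ∫⁻ x : ℝ, (‖f x - F x‖ₑ + ‖g x - G x‖ₑ) ∂μ := by
        refine lintegral_mono fun x => ?_
        rw [Pi.add_apply, add_sub_add_comm]
        exact enorm_add_le _ _
    _ = ∫⁻ x : ℝ, ‖f x - F x‖ₑ ∂μ + ∫⁻ x : ℝ, ‖g x - G x‖ₑ ∂μ :=
        lintegral_add_left' (hf.1.sub (hL F hF)).1.enorm _
    _ < ENNReal.ofReal (ε / 2) + ENNReal.ofReal (ε / 2) := ENNReal.add_lt_add hfF hgG
    _ = ENNReal.ofReal ε := by
        rw [← ENNReal.ofReal_add (by positivity) (by positivity), add_halves]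

lemma memClosL1_of_mem (hL : ∀ F ∈ L, Integrable (fun x : ℝ => F x) μ) {F : ℂ → ℂ} (hF : F ∈ L) :
    MemClosL1 μ L (fun x : ℝ => F x) :=
  ⟨hL F hF, fun ε hε => ⟨F, hF, by simpa using hε⟩⟩

lemma MemClosL1.conj (hsharp : ∀ F ∈ L, (fun z => (starRingEnd ℂ) (F ((starRingEnd ℂ) z))) ∈ L)
    {f : ℝ → ℂ} (hf : MemClosL1 μ L f) : MemClosL1 μ L (fun x => (starRingEnd ℂ) (f x)) := by
  refine ⟨hf.1.congr'_enorm ?_ ?_, fun ε hε => ?_⟩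
  · exact (Complex.continuous_conj.measurable.comp_aemeasurable
      hf.1.1.aemeasurable).aestronglyMeasurable
  · exact ae_of_all _ fun x => (RCLike.enorm_conj _).symm
  · obtain ⟨F, hF, hfF⟩ := hf.2 ε hε
    refine ⟨_, hsharp F hF, ?_⟩
    convert hfF using 4 with x
    rw [Complex.conj_ofReal, ← map_sub, RCLike.nnnorm_conj]

/-- The functions that multiply `L` into its closure in `L¹(μ)`. -/
def IsMultiplier (μ : Measure ℝ) (L : Submodule ℂ (ℂ → ℂ)) (b : ℝ → ℂ) : Prop :=
  Continuous b ∧ (∃ C : ℝ, ∀ x, ‖b x‖ ≤ C) ∧ ∀ F ∈ L, MemClosL1 μ L (fun x : ℝ => b x * F x)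

lemma IsMultiplier.memClosL1_mul {b f : ℝ → ℂ} (hb : IsMultiplier μ L b) (hf : MemClosL1 μ L f) : MemClosL1 μ L (fun x => b x * f x) := by
  obtain ⟨hbc, ⟨C, hC⟩, hbL⟩ := hb
  have hC0 : 0 ≤ C := (norm_nonneg _).trans (hC 0)
  refine .of_forall_exists (hf.1.bdd_mul hbc.aestronglyMeasurable (ae_of_all _ hC)) fun ε hε => ?_
  obtain ⟨F, hF, hfF⟩ := hf.2 (ε / (C + 1)) (by positivity)
  refine ⟨_, hbL F hF, ?_⟩
  calc ∫⁻ x : ℝ, ‖b x * f x - b x * F x‖ₑ ∂μ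
      ≤ ∫⁻ x : ℝ, ENNReal.ofReal (C + 1) * ‖f x - F x‖ₑ ∂μ := by
        refine lintegral_mono fun x => ?_
        rw [← mul_sub, enorm_mul]
        gcongr
        rw [← ofReal_norm]
        exact ENNReal.ofReal_le_ofReal ((hC x).trans (by linarith))
    _ = ENNReal.ofReal (C + 1) * ∫⁻ x : ℝ, ‖f x - F x‖ₑ ∂μ :=
        lintegral_const_mul' _ _ ENNReal.ofReal_ne_top
    _ ≤ ENNReal.ofReal (C + 1) * ENNReal.ofReal (ε / (C + 1)) := by
        gcongr
        exact hfF.le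
    _ = ENNReal.ofReal ε := by
        rw [← ENNReal.ofReal_mul (by positivity), mul_div_cancel₀ _ (by positivity)]

lemma isMultiplier_const (hL : ∀ F ∈ L, Integrable (fun x : ℝ => F x) μ) (r : ℂ) :
    IsMultiplier μ L (fun _ => r) :=
  ⟨continuous_const, ⟨‖r‖, fun _ => le_rfl⟩, fun _ hF =>
    memClosL1_of_mem hL (L.smul_mem r hF)⟩

lemma IsMultiplier.mul {b₁ b₂ : ℝ → ℂ} (h₁ : IsMultiplier μ L b₁)
    (h₂ : IsMultiplier μ L b₂) : IsMultiplier μ L (fun x => b₁ x * b₂ x) := by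
  obtain ⟨C₁, hC₁⟩ := h₁.2.1
  obtain ⟨C₂, hC₂⟩ := h₂.2.1
  refine ⟨h₁.1.mul h₂.1, ⟨C₁ * C₂, fun x => ?_⟩, fun F hF => ?_⟩
  · rw [norm_mul]
    exact mul_le_mul (hC₁ x) (hC₂ x) (norm_nonneg _) ((norm_nonneg _).trans (hC₁ x))
  · simpa only [mul_assoc] using h₁.memClosL1_mul (h₂.2.2 F hF)

lemma IsMultiplier.add (hL : ∀ F ∈ L, Integrable (fun x : ℝ => F x) μ) {b₁ b₂ : ℝ → ℂ}
    (h₁ : IsMultiplier μ L b₁) (h₂ : IsMultiplier μ L b₂) :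
    IsMultiplier μ L (fun x => b₁ x + b₂ x) := by
  obtain ⟨C₁, hC₁⟩ := h₁.2.1
  obtain ⟨C₂, hC₂⟩ := h₂.2.1
  refine ⟨h₁.1.add h₂.1, ⟨C₁ + C₂, fun x => norm_add_le_of_le (hC₁ x) (hC₂ x)⟩, fun F hF => ?_⟩
  simpa only [add_mul] using (h₁.2.2 F hF).add hL (h₂.2.2 F hF)

lemma IsMultiplier.conj (hsharp : ∀ F ∈ L, (fun z => (starRingEnd ℂ) (F ((starRingEnd ℂ) z))) ∈ L)
    {b : ℝ → ℂ} (hb : IsMultiplier μ L b) : IsMultiplier μ L (fun x => (starRingEnd ℂ) (b x)) := by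
  obtain ⟨hbc, ⟨C, hC⟩, hbL⟩ := hb
  refine ⟨Complex.continuous_conj.comp hbc, ⟨C, fun x => by simpa using hC x⟩, fun F hF => ?_⟩
  simpa using (hbL _ (hsharp F hF)).conj hsharp

lemma IsMultiplier.of_forall_exists (hL : ∀ F ∈ L, Integrable (fun x : ℝ => F x) μ) {b : ℝ → ℂ}
    (hb : Continuous b)
    (h : ∀ ε : ℝ, 0 < ε → ∃ b', IsMultiplier μ L b' ∧ ∀ x, ‖b x - b' x‖ ≤ ε) :
    IsMultiplier μ L b := by
  have hbdd : ∃ C : ℝ, ∀ x, ‖b x‖ ≤ C := by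
    obtain ⟨b', hb', hbb'⟩ := h 1 one_pos
    obtain ⟨C, hC⟩ := hb'.2.1
    refine ⟨1 + C, fun x => ?_⟩
    have := norm_add_le_of_le (hbb' x) (hC x)
    simpa using this
  refine ⟨hb, hbdd, fun F hF => ?_⟩
  obtain ⟨C, hC⟩ := hbdd
  have hFi := hL F hF
  refine .of_forall_exists (hFi.bdd_mul hb.aestronglyMeasurable (ae_of_all _ hC)) fun ε hε => ?_
  have hI : 0 ≤ ∫ x : ℝ, ‖F x‖ ∂μ := integral_nonneg fun _ => norm_nonneg _
  obtain ⟨b', hb', hbb'⟩ := h (ε / (∫ x : ℝ, ‖F x‖ ∂μ + 1)) (by positivity)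
  refine ⟨_, hb'.2.2 F hF, ?_⟩
  calc ∫⁻ x : ℝ, ‖b x * F x - b' x * F x‖ₑ ∂μ
      ≤ ∫⁻ x : ℝ, ENNReal.ofReal (ε / (∫ x : ℝ, ‖F x‖ ∂μ + 1)) * ‖F x‖ₑ ∂μ := by
        refine lintegral_mono fun x => ?_
        rw [← sub_mul, enorm_mul]
        gcongr
        rw [← ofReal_norm]
        exact ENNReal.ofReal_le_ofReal (hbb' x)
    _ = ENNReal.ofReal (ε / (∫ x : ℝ, ‖F x‖ ∂μ + 1)) * ∫⁻ x : ℝ, ‖F x‖ₑ ∂μ :=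
        lintegral_const_mul' _ _ ENNReal.ofReal_ne_top
    _ = ENNReal.ofReal (ε / (∫ x : ℝ, ‖F x‖ ∂μ + 1) * ∫ x : ℝ, ‖F x‖ ∂μ) := by
        rw [← ofReal_integral_norm_eq_lintegral_enorm hFi, ENNReal.ofReal_mul (by positivity)]
    _ ≤ ENNReal.ofReal ε := by
        refine ENNReal.ofReal_le_ofReal ?_
        rw [div_mul_eq_mul_div, div_le_iff₀ (by positivity)]
        nlinarith

end closure

lemma norm_inv_ofReal_sub_le {c : ℂ} (hc : 0 < c.im) (x : ℝ) : ‖((x : ℂ) - c)⁻¹‖ ≤ 1 / c.im := by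
  rw [norm_inv, ← one_div]
  gcongr
  have := Complex.abs_im_le_norm ((x : ℂ) - c)
  simpa [abs_of_pos hc] using this

lemma ofReal_sub_ne_zero {c : ℂ} (hc : 0 < c.im) (x : ℝ) : (x : ℂ) - c ≠ 0 := by
  intro h
  have := congrArg Complex.im h
  simp at this
  linarith

/-- A compactly supported continuous function on the line is a continuous function of the
resolvent `x ↦ (x - c)⁻¹`. -/
lemma exists_continuous_comp_inv_sub {k : ℝ → ℂ} (hk : Continuous k) (hks : HasCompactSupport k)
    {c : ℂ} (hc : 0 < c.im) :
    ∃ f : ℂ → ℂ, Continuous f ∧ ∀ x : ℝ, f (((x : ℂ) - c)⁻¹) = k x := by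
  obtain ⟨A, hA⟩ := hks.isBounded.exists_norm_le
  let K : ℂ → ℂ := fun z => k z.re * (max 0 (1 - |z.im|) : ℝ)
  have hKc : Continuous K := by fun_prop
  have hK0 : ∀ z : ℂ, A + 1 < ‖z‖ → K z = 0 := by
    intro z hz
    have h := hz.trans_le (Complex.norm_le_abs_re_add_abs_im z)
    by_cases hre : z.re ∈ tsupport k
    · have := hA _ hre
      rw [Real.norm_eq_abs] at this
      simp only [K]
      rw [max_eq_left (by linarith)]
      simp
    · simp [K, image_eq_zero_of_notMem_tsupport hre]
  let f : ℂ → ℂ := fun v => if v = 0 then 0 else K (v⁻¹ + c)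
  refine ⟨f, continuous_iff_continuousAt.2 fun v => ?_, fun x => ?_⟩
  · by_cases hv : v = 0
    · subst hv
      rw [continuousAt_iff_punctured_nhds]
      refine tendsto_const_nhds.congr' ?_
      have h1 : Tendsto (fun v : ℂ => ‖v⁻¹‖) (nhdsWithin 0 {0}ᶜ) atTop :=
        tendsto_norm_cobounded_atTop.comp tendsto_inv₀_nhdsNE_zero
      filter_upwards [h1.eventually_gt_atTop (A + 1 + ‖c‖), self_mem_nhdsWithin] with v hv hv0
      have : v ≠ 0 := hv0
      simp only [f, if_true, this, if_false]
      refine (hK0 _ ?_).symm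
      have := norm_sub_norm_le v⁻¹ (-c)
      rw [sub_neg_eq_add, norm_neg] at this
      linarith
    · have : (fun v => K (v⁻¹ + c)) =ᶠ[nhds v] f := by
        filter_upwards [isOpen_ne.mem_nhds hv] with u hu
        have : u ≠ 0 := hu
        simp [f, this]
      refine ContinuousAt.congr ?_ this
      exact hKc.continuousAt.comp ((continuousAt_inv₀ hv).add continuousAt_const)
  · simp [f, K, ofReal_sub_ne_zero hc x]

section density

variable {μ : Measure ℝ} {L : Submodule ℂ (ℂ → ℂ)}

lemma IsMultiplier.of_hasCompactSupport (hL : ∀ F ∈ L, Integrable (fun x : ℝ => F x) μ)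
    (hsharp : ∀ F ∈ L, (fun z => (starRingEnd ℂ) (F ((starRingEnd ℂ) z))) ∈ L)
    {c : ℂ} (hc : 0 < c.im) (hr : IsMultiplier μ L (fun x : ℝ => ((x : ℂ) - c)⁻¹))
    {k : ℝ → ℂ} (hk : Continuous k) (hks : HasCompactSupport k) : IsMultiplier μ L k := by
  let s : Set ℂ := Metric.closedBall 0 (1 / c.im)
  have hmem : ∀ x : ℝ, ((x : ℂ) - c)⁻¹ ∈ s := fun x => by
    simpa only [s, mem_closedBall_zero_iff] using norm_inv_ofReal_sub_le hc x
  have : CompactSpace s := isCompact_iff_compactSpace.1 (isCompact_closedBall _ _)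
  have hcont : Continuous fun x : ℝ => (⟨((x : ℂ) - c)⁻¹, hmem x⟩ : s) := hr.1.subtype_mk _
  have main : ∀ f : C(s, ℂ), IsMultiplier μ L (fun x : ℝ => f ⟨((x : ℂ) - c)⁻¹, hmem x⟩) := by
    intro f
    induction f using ContinuousMap.induction_on_of_compact with
    | const r => exact isMultiplier_const hL r
    | id => exact hr
    | star_id => exact hr.conj hsharp
    | add f g hf hg => exact hf.add hL hg
    | mul f g hf hg => exact hf.mul hg
    | frequently f hf =>
      refine .of_forall_exists hL (f.continuous.comp hcont) fun ε hε => ?_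
      obtain ⟨g, hg, hfg⟩ := (hf.and_eventually (Metric.ball_mem_nhds f hε)).exists
      refine ⟨_, hg, fun x => ?_⟩
      rw [← dist_eq_norm]
      refine (ContinuousMap.dist_apply_le_dist _).trans ?_
      rw [dist_comm]
      exact (Metric.mem_ball.1 hfg).le
  obtain ⟨f, hf, hfk⟩ := exists_continuous_comp_inv_sub hk hks hc
  simpa [hfk] using main ⟨fun v => f v, hf.comp continuous_subtype_val⟩

lemma denseL1_of_isMultiplier [IsLocallyFiniteMeasure μ]
    (hL : ∀ F ∈ L, Integrable (fun x : ℝ => F x) μ) (hc : ∀ F ∈ L, Continuous F)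
    (hne : ∀ x : ℝ, ∃ G ∈ L, G x ≠ 0)
    (hk : ∀ k : ℝ → ℂ, Continuous k → HasCompactSupport k → IsMultiplier μ L k) :
    DenseL1 μ L := by
  have key : ∀ K : Set ℝ, IsCompact K → ∃ S : ℝ → ℝ, Continuous S ∧ (∀ x, 0 ≤ S x) ∧
      (∀ x ∈ K, 0 < S x) ∧ ∀ k : ℝ → ℂ, Continuous k → HasCompactSupport k →
        MemClosL1 μ L (fun x => k x * S x) := by
    intro K hK
    refine IsCompact.induction_on hK ?_ ?_ ?_ ?_
    · refine ⟨fun _ => 0, continuous_const, fun _ => le_rfl, by simp, fun k _ _ => ?_⟩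
      simpa using memClosL1_of_mem hL L.zero_mem
    · rintro s t hst ⟨S, h1, h2, h3, h4⟩
      exact ⟨S, h1, h2, fun x hx => h3 x (hst hx), h4⟩
    · rintro s t ⟨S, h1, h2, h3, h4⟩ ⟨T, i1, i2, i3, i4⟩
      refine ⟨fun x => S x + T x, h1.add i1, fun x => add_nonneg (h2 x) (i2 x), ?_, ?_⟩
      · rintro x (hx | hx)
        · exact add_pos_of_pos_of_nonneg (h3 x hx) (i2 x)
        · exact add_pos_of_nonneg_of_pos (h2 x) (i3 x hx)
      · intro k hkc hks
        simpa [mul_add] using (h4 k hkc hks).add hL (i4 k hkc hks)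
    · intro x _
      obtain ⟨G, hG, hGx⟩ := hne x
      have hGc : Continuous fun y : ℝ => G y := (hc G hG).comp Complex.continuous_ofReal
      refine ⟨{y : ℝ | G y ≠ 0}, mem_nhdsWithin_of_mem_nhds ?_, fun y => ‖G y‖ ^ 2,
        hGc.norm.pow 2, fun y => by positivity, fun y hy => ?_, fun k hkc hks => ?_⟩
      · exact (isOpen_ne.preimage hGc).mem_nhds hGx
      · have : G y ≠ 0 := hy
        positivity
      · have := (hk (fun y => k y * (starRingEnd ℂ) (G y))
          (hkc.mul (Complex.continuous_conj.comp hGc)) hks.mul_right).2.2 G hG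
        convert this using 2 with y
        rw [mul_assoc, mul_comm ((starRingEnd ℂ) _), Complex.mul_conj, Complex.normSq_eq_norm_sq]
  have hCc : ∀ k : ℝ → ℂ, Continuous k → HasCompactSupport k → MemClosL1 μ L k := by
    intro k hkc hks
    obtain ⟨S, h1, h2, h3, h4⟩ := key _ hks
    obtain ⟨m, hm, hmS⟩ := IsCompact.exists_forall_le' hks h1.continuousOn h3
    have := h4 (fun x => k x * ((max m (S x) : ℝ) : ℂ)⁻¹) ?_ hks.mul_right
    · convert this using 2 with x
      by_cases hx : x ∈ tsupport k
      · have hS : (S x : ℂ) ≠ 0 := by exact_mod_cast (h3 x hx).ne'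
        rw [max_eq_right (hmS x hx), inv_mul_cancel_right₀ hS]
      · simp [image_eq_zero_of_notMem_tsupport hx]
    · refine hkc.mul (Continuous.inv₀ (by fun_prop) fun x => ?_)
      exact_mod_cast (hm.trans_le (le_max_left m (S x))).ne'
  refine fun f hf => .of_forall_exists hf fun ε hε => ?_
  obtain ⟨g, hg, hfg, hgc, -⟩ := hf.exists_hasCompactSupport_lintegral_sub_le
    (ENNReal.ofReal_pos.2 hε).ne'
  exact ⟨g, hCc g hgc hg, hfg⟩

end density

/-- The elements of a nontrivial algebraic de Branges space have no common zeros. -/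
lemma IsAlgebraicDeBranges.exists_apply_ne_zero {L : Submodule ℂ (ℂ → ℂ)}
    (hdb : IsAlgebraicDeBranges L) (hne : L ≠ ⊥) (w : ℂ) : ∃ G ∈ L, G w ≠ 0 := by
  by_contra! hall
  obtain ⟨F, hF, hF0⟩ := L.exists_mem_ne_zero_of_ne_bot hne
  have hdiv : ∀ n : ℕ, ∃ G ∈ L, ∀ z, F z = (z - w) ^ n * G z := by
    intro n
    induction n with
    | zero => exact ⟨F, hF, by simp⟩
    | succ n ih =>
      obtain ⟨G, hG, hFG⟩ := ih
      obtain ⟨H, hH, hGH⟩ := hdb.2.1 G hG w (hall G hG)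
      refine ⟨H, hH, fun z => ?_⟩
      by_cases hz : z = w
      · simp [hz, hall F hF]
      · have := sub_ne_zero.2 hz
        rw [hFG z, hGH z hz]
        field_simp
        ring
  have hFa : AnalyticAt ℂ F w := (hdb.1 F hF).analyticAt w
  have htop : analyticOrderAt F w = ⊤ := by
    refine ENat.eq_top_iff_forall_ge.2 fun n => ?_
    rw [natCast_le_analyticOrderAt hFa]
    obtain ⟨G, hG, hFG⟩ := hdiv n
    exact ⟨G, (hdb.1 G hG).analyticAt w, .of_forall fun z => by simpa using hFG z⟩
  refine hF0 (AnalyticOnNhd.eq_of_eventuallyEq (z₀ := w)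
    (fun z _ => (hdb.1 F hF).analyticAt z) (fun z _ => analyticAt_const) ?_)
  exact analyticOrderAt_eq_top.1 htop

/-- The Hahn–Banach theorem for the closure of `L` in `L¹(μ)`. -/
lemma exists_annihilator {μ : Measure ℝ} {L : Submodule ℂ (ℂ → ℂ)}
    (hL : ∀ F ∈ L, Integrable (fun x : ℝ => F x) μ) {h : ℝ → ℂ} (hh : Integrable h μ)
    (hmem : ¬ MemClosL1 μ L h) :
    ∃ (Λ : (ℝ → ℂ) → ℂ) (C : ℝ), 0 < C ∧
      (∀ f g, Integrable f μ → Integrable g μ → Λ (fun x => f x - g x) = Λ f - Λ g) ∧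
      (∀ (a : ℂ) (f), Integrable f μ → Λ (fun x => a * f x) = a * Λ f) ∧
      (∀ f, Integrable f μ → ‖Λ f‖ ≤ C * ∫ x, ‖f x‖ ∂μ) ∧
      (∀ F ∈ L, Λ (fun x : ℝ => F x) = 0) ∧ Λ h ≠ 0 := by
  let W : Submodule ℂ (Lp ℂ 1 μ) :=
    { carrier := {u | ∃ F, ∃ hF : F ∈ L, u = (hL F hF).toL1}
      zero_mem' := ⟨0, L.zero_mem, (Integrable.toL1_zero _).symm⟩
      add_mem' := by
        rintro _ _ ⟨F, hF, rfl⟩ ⟨G, hG, rfl⟩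
        exact ⟨F + G, L.add_mem hF hG, (Integrable.toL1_add _ _ _ _).symm⟩
      smul_mem' := by
        rintro a _ ⟨F, hF, rfl⟩
        exact ⟨a • F, L.smul_mem a hF, (Integrable.toL1_smul _ _ _).symm⟩ }
  let V := W.topologicalClosure
  have hV : IsClosed (V : Set (Lp ℂ 1 μ)) := W.isClosed_topologicalClosure
  have hhV : hh.toL1 h ∉ V := by
    intro hcl
    refine hmem ⟨hh, fun ε hε => ?_⟩
    obtain ⟨u, ⟨F, hF, rfl⟩, hu⟩ := EMetric.mem_closure_iff.1 hcl _ (ENNReal.ofReal_pos.2 hε)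
    refine ⟨F, hF, ?_⟩
    rw [Integrable.edist_toL1_toL1] at hu
    simpa only [edist_eq_enorm_sub, enorm_eq_nnnorm] using hu
  have : IsClosed (V.toAddSubgroup : Set (Lp ℂ 1 μ)) := hV
  obtain ⟨ψ, hψ⟩ := SeparatingDual.exists_ne_zero (R := ℂ) (x := V.mkQL (hh.toL1 h))
    (by simpa using hhV)
  let φ : Lp ℂ 1 μ →L[ℂ] ℂ := ψ.comp V.mkQL
  obtain ⟨Λ, hΛ⟩ : ∃ Λ : (ℝ → ℂ) → ℂ, ∀ f (hf : Integrable f μ), Λ f = φ (hf.toL1 f) := by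
    classical
    exact ⟨fun f => if hf : Integrable f μ then φ (hf.toL1 f) else 0, fun f hf => dif_pos hf⟩
  refine ⟨Λ, ‖φ‖ + 1, by positivity, fun f g hf hg => ?_, fun a f hf => ?_, fun f hf => ?_,
    fun F hF => ?_, ?_⟩
  · rw [hΛ f hf, hΛ g hg, ← map_sub, ← Integrable.toL1_sub]
    exact hΛ _ (hf.sub hg)
  · rw [hΛ f hf, ← smul_eq_mul, ← map_smul, ← Integrable.toL1_smul]
    exact hΛ _ (hf.smul a)
  · rw [hΛ f hf]
    refine (φ.le_opNorm _).trans ?_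
    have : ‖hf.toL1 f‖ = ∫ x, ‖f x‖ ∂μ := by
      rw [Integrable.norm_toL1_eq_lintegral_enorm, ← ofReal_integral_norm_eq_lintegral_enorm hf,
        ENNReal.toReal_ofReal (integral_nonneg fun _ => norm_nonneg _)]
    rw [this]
    gcongr
    linarith
  · have : V.mkQL ((hL F hF).toL1) = 0 := by
      simpa using W.le_topologicalClosure ⟨F, hF, rfl⟩
    simp [hΛ _ (hL F hF), φ, this]
  · rw [hΛ h hh]
    exact hψ

lemma continuous_inv_ofReal_sub {c : ℂ} (hc : 0 < c.im) :
    Continuous fun x : ℝ => ((x : ℂ) - c)⁻¹ :=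
  Continuous.inv₀ (by fun_prop) (ofReal_sub_ne_zero hc)

/-- If `L` is not dense, then some resolvent of multiplication by the independent variable does
not map `L` into its closure. -/
lemma exists_not_memClosL1_inv_sub_mul {μ : Measure ℝ} [IsLocallyFiniteMeasure μ]
    {L : Submodule ℂ (ℂ → ℂ)} (hdb : IsAlgebraicDeBranges L)
    (hL : ∀ F ∈ L, Integrable (fun x : ℝ => F x) μ) (hnd : ¬ DenseL1 μ L) (hne : L ≠ ⊥)
    {c : ℂ} (hc : 0 < c.im) : ∃ G ∈ L, ¬ MemClosL1 μ L (fun x : ℝ => ((x : ℂ) - c)⁻¹ * G x) := by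
  by_contra! hall
  have hr : IsMultiplier μ L (fun x : ℝ => ((x : ℂ) - c)⁻¹) :=
    ⟨continuous_inv_ofReal_sub hc, ⟨_, norm_inv_ofReal_sub_le hc⟩, hall⟩
  exact hnd (denseL1_of_isMultiplier hL (fun F hF => (hdb.1 F hF).continuous)
    (fun x => hdb.exists_apply_ne_zero hne x)
    fun k hkc hks => hr.of_hasCompactSupport hL hdb.2.2 hc hkc hks)

/-- Differentiability in `w` of `Λ (F / (· - w))` for an `L¹`-bounded linear functional `Λ`. -/
lemma hasDerivAt_apply_inv_sub_mul {μ : Measure ℝ} {Λ : (ℝ → ℂ) → ℂ} {C : ℝ} (hC : 0 < C)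
    (hsub : ∀ f g, Integrable f μ → Integrable g μ → Λ (fun x => f x - g x) = Λ f - Λ g)
    (hsmul : ∀ (a : ℂ) (f), Integrable f μ → Λ (fun x => a * f x) = a * Λ f)
    (hbd : ∀ f, Integrable f μ → ‖Λ f‖ ≤ C * ∫ x, ‖f x‖ ∂μ)
    {f : ℝ → ℂ} (hf : Integrable f μ) {w : ℂ} (hw : 0 < w.im) :
    HasDerivAt (fun w : ℂ => Λ (fun x : ℝ => ((x : ℂ) - w)⁻¹ * f x))
      (Λ (fun x : ℝ => ((x : ℂ) - w)⁻¹ ^ 2 * f x)) w := by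
  have hint : ∀ v : ℂ, 0 < v.im → Integrable (fun x : ℝ => ((x : ℂ) - v)⁻¹ * f x) μ := fun v hv =>
    hf.bdd_mul (continuous_inv_ofReal_sub hv).aestronglyMeasurable
      (ae_of_all _ (norm_inv_ofReal_sub_le hv))
  have hint2 : Integrable (fun x : ℝ => ((x : ℂ) - w)⁻¹ ^ 2 * f x) μ := by
    refine hf.bdd_mul (c := (1 / w.im) ^ 2)
      ((continuous_inv_ofReal_sub hw).pow 2).aestronglyMeasurable (ae_of_all _ fun x => ?_)
    rw [norm_pow]
    exact pow_le_pow_left₀ (norm_nonneg _) (norm_inv_ofReal_sub_le hw x) 2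
  have hI : 0 ≤ ∫ x, ‖f x‖ ∂μ := integral_nonneg fun _ => norm_nonneg _
  rw [hasDerivAt_iff_isLittleO]
  refine Asymptotics.IsBigO.trans_isLittleO (g := fun v => ‖v - w‖ ^ 2) ?_
    (Asymptotics.isLittleO_pow_sub_sub w one_lt_two)
  refine Asymptotics.IsBigO.of_bound
    (C * ((2 / w.im) * (1 / w.im) ^ 2 * ∫ x, ‖f x‖ ∂μ)) ?_
  have hev : ∀ᶠ v : ℂ in nhds w, w.im / 2 < v.im :=
    Complex.continuous_im.continuousAt.eventually_const_lt (by linarith)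
  filter_upwards [hev] with v hv
  have hv0 : 0 < v.im := by linarith
  have e1 : (fun x : ℝ => ((x : ℂ) - v)⁻¹ * f x - ((x : ℂ) - w)⁻¹ * f x -
      (v - w) * (((x : ℂ) - w)⁻¹ ^ 2 * f x)) =
      fun x : ℝ => (v - w) ^ 2 * (((x : ℂ) - v)⁻¹ * ((x : ℂ) - w)⁻¹ ^ 2 * f x) := by
    funext x
    have := ofReal_sub_ne_zero hv0 x
    have := ofReal_sub_ne_zero hw x
    field_simp
    ring
  have e2 : Λ (fun x : ℝ => ((x : ℂ) - v)⁻¹ * f x) - Λ (fun x : ℝ => ((x : ℂ) - w)⁻¹ * f x) -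
      (v - w) * Λ (fun x : ℝ => ((x : ℂ) - w)⁻¹ ^ 2 * f x) =
      Λ (fun x : ℝ => (v - w) ^ 2 * (((x : ℂ) - v)⁻¹ * ((x : ℂ) - w)⁻¹ ^ 2 * f x)) := by
    rw [← e1, hsub (fun x : ℝ => ((x : ℂ) - v)⁻¹ * f x - ((x : ℂ) - w)⁻¹ * f x)
      (fun x : ℝ => (v - w) * (((x : ℂ) - w)⁻¹ ^ 2 * f x)) ((hint v hv0).sub (hint w hw)) (hint2.const_mul _),
      hsub _ _ (hint v hv0) (hint w hw), hsmul _ _ hint2]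
  have hb : ∀ x : ℝ, ‖(v - w) ^ 2 * (((x : ℂ) - v)⁻¹ * ((x : ℂ) - w)⁻¹ ^ 2 * f x)‖ ≤
      ‖v - w‖ ^ 2 * ((2 / w.im) * (1 / w.im) ^ 2 * ‖f x‖) := by
    intro x
    rw [norm_mul, norm_mul, norm_mul, norm_pow, norm_pow]
    have h1 : ‖((x : ℂ) - v)⁻¹‖ ≤ 2 / w.im := by
      refine (norm_inv_ofReal_sub_le hv0 x).trans ?_
      rw [div_le_div_iff₀ hv0 hw]
      linarith
    have h2 := norm_inv_ofReal_sub_le hw x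
    gcongr
  rw [smul_eq_mul, e2, norm_pow, norm_norm]
  have hi3 : Integrable
      (fun x : ℝ => (v - w) ^ 2 * (((x : ℂ) - v)⁻¹ * ((x : ℂ) - w)⁻¹ ^ 2 * f x)) μ := by
    rw [← e1]
    exact ((hint v hv0).sub (hint w hw)).sub (hint2.const_mul _)
  refine (hbd _ hi3).trans ?_
  calc _ ≤ C * ∫ x, ‖v - w‖ ^ 2 * ((2 / w.im) * (1 / w.im) ^ 2 * ‖f x‖) ∂μ := by
        gcongr
        · exact hi3.norm
        · exact (hf.norm.const_mul _).const_mul _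
        · exact hb
    _ = _ := by
        rw [integral_const_mul, integral_const_mul]
        ring

/-- Cauchy transforms with respect to a functional annihilating `L`. -/
lemma exists_cauchy_transform {μ : Measure ℝ} [IsLocallyFiniteMeasure μ]
    {L : Submodule ℂ (ℂ → ℂ)} (hdb : IsAlgebraicDeBranges L)
    (hL : ∀ F ∈ L, Integrable (fun x : ℝ => F x) μ) (hnd : ¬ DenseL1 μ L) (hne : L ≠ ⊥)
    {c : ℂ} (hc : 0 < c.im) :
    ∃ (K : (ℂ → ℂ) → ℂ → ℂ) (C : ℝ) (G : ℂ → ℂ), 0 < C ∧ G ∈ L ∧ K G c ≠ 0 ∧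
      (∀ F ∈ L, DifferentiableOn ℂ (K F) {w | 0 < w.im}) ∧
      (∀ F ∈ L, ∀ w : ℂ, 0 < w.im → ‖K F w‖ ≤ C * (∫ x : ℝ, ‖F x‖ ∂μ) / w.im) ∧
      ∀ F ∈ L, ∀ w : ℂ, 0 < w.im → F w * K G w = G w * K F w := by
  obtain ⟨G, hG, hGc⟩ := exists_not_memClosL1_inv_sub_mul hdb hL hnd hne hc
  have hint : ∀ F ∈ L, ∀ w : ℂ, 0 < w.im →
      Integrable (fun x : ℝ => ((x : ℂ) - w)⁻¹ * F x) μ := fun F hF w hw =>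
    (hL F hF).bdd_mul (continuous_inv_ofReal_sub hw).aestronglyMeasurable
      (ae_of_all _ (norm_inv_ofReal_sub_le hw))
  obtain ⟨Λ, C, hC, hsub, hsmul, hbd, hann, hΛ⟩ := exists_annihilator hL (hint G hG c hc) hGc
  refine ⟨fun F w => Λ (fun x : ℝ => ((x : ℂ) - w)⁻¹ * F x), C, G, hC, hG, hΛ, ?_, ?_, ?_⟩
  · intro F hF w hw
    exact (hasDerivAt_apply_inv_sub_mul hC hsub hsmul hbd (hL F hF)
      hw).differentiableAt.differentiableWithinAt
  · intro F hF w hw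
    refine (hbd _ (hint F hF w hw)).trans ?_
    rw [mul_div_assoc, div_eq_mul_one_div (∫ x : ℝ, ‖F x‖ ∂μ), mul_comm (∫ x : ℝ, ‖F x‖ ∂μ),
      ← integral_const_mul (1 / w.im)]
    refine mul_le_mul_of_nonneg_left (integral_mono (hint F hF w hw).norm
      ((hL F hF).norm.const_mul _) fun x => ?_) hC.le
    simp only [norm_mul]
    gcongr
    exact norm_inv_ofReal_sub_le hw x
  · intro F hF w hw
    have hH : F w • G - G w • F ∈ L := L.sub_mem (L.smul_mem _ hG) (L.smul_mem _ hF)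
    obtain ⟨H, hHL, hHeq⟩ := hdb.2.1 _ hH w (by simp [mul_comm])
    have e : (fun x : ℝ => H x) = fun x : ℝ =>
        F w * (((x : ℂ) - w)⁻¹ * G x) - G w * (((x : ℂ) - w)⁻¹ * F x) := by
      funext x
      rw [hHeq x (sub_ne_zero.1 (ofReal_sub_ne_zero hw x)), div_eq_mul_inv]
      simp only [Pi.sub_apply, Pi.smul_apply, smul_eq_mul]
      ring
    have h0 := hann H hHL
    rw [e, hsub _ _ ((hint G hG w hw).const_mul _) ((hint F hF w hw).const_mul _),
      hsmul _ _ (hint G hG w hw), hsmul _ _ (hint F hF w hw)] at h0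
    exact sub_eq_zero.1 h0

lemma sq_norm_sub_lt_of_mem_ball {v ρ : ℝ} (hρ : 0 < ρ) {w : ℂ}
    (hw : w ∈ Metric.ball (v + ρ * Complex.I : ℂ) ρ) : ‖w - v‖ ^ 2 < 2 * ρ * w.im := by
  rw [Metric.mem_ball, dist_eq_norm, ← sq_lt_sq₀ (norm_nonneg _) hρ.le, Complex.sq_norm,
    Complex.normSq_apply] at hw
  rw [Complex.sq_norm, Complex.normSq_apply]
  simp at hw ⊢
  linarith

/-- The unit ball of a non-dense algebraic de Branges space is locally bounded in discs tangent
to the real line, with control at the boundary. -/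
lemma exists_bound_on_tangent_ball {μ : Measure ℝ} [IsLocallyFiniteMeasure μ]
    {L : Submodule ℂ (ℂ → ℂ)} (hdb : IsAlgebraicDeBranges L)
    (hL : ∀ F ∈ L, Integrable (fun x : ℝ => F x) μ) (hnd : ¬ DenseL1 μ L) (hne : L ≠ ⊥)
    (v : ℝ) {ρ : ℝ} (hρ : 0 < ρ) :
    ∃ M : ℝ, 0 < M ∧ ∀ F ∈ L, ∫ x : ℝ, ‖F x‖ ∂μ ≤ 1 → ∀ w : ℂ,
      ‖w - (v + ρ * Complex.I)‖ < ρ →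
      ‖F w‖ ≤ Real.exp (4 * M * ρ / (ρ - ‖w - (v + ρ * Complex.I)‖)) := by
  set c : ℂ := v + ρ * Complex.I with hcdef
  have hc : 0 < c.im := by simpa [c] using hρ
  have hcv : c - v ≠ 0 := by simp [c, hρ.ne']
  obtain ⟨K, C, G, hC, hG, hKc, hKd, hKb, hKG⟩ := exists_cauchy_transform hdb hL hnd hne hc
  obtain ⟨S, hS⟩ := (isCompact_closedBall c ρ).exists_bound_of_continuousOn
    (hdb.1 G hG).continuous.continuousOn
  have hS0 : 0 ≤ S := (norm_nonneg _).trans (hS c (by simpa using hρ.le))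
  have hI : 0 ≤ ∫ x : ℝ, ‖G x‖ ∂μ := integral_nonneg fun _ => norm_nonneg _
  have him : ∀ w ∈ Metric.ball c ρ, 0 < w.im := fun w hw => by
    have := sq_norm_sub_lt_of_mem_ball hρ hw
    have := sq_nonneg ‖w - v‖
    by_contra! h
    nlinarith
  have hprod : ∀ F ∈ L, ∀ w ∈ Metric.ball c ρ,
      ‖w - v‖ ^ 2 * ‖K F w‖ ≤ 2 * ρ * C * ∫ x : ℝ, ‖F x‖ ∂μ := by
    intro F hF w hw
    have h0 := him w hw
    calc ‖w - v‖ ^ 2 * ‖K F w‖ ≤ (2 * ρ * w.im) * (C * (∫ x : ℝ, ‖F x‖ ∂μ) / w.im) :=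
          mul_le_mul (sq_norm_sub_lt_of_mem_ball hρ hw).le (hKb F hF w h0) (norm_nonneg _)
            (by positivity)
      _ = _ := by field_simp
  let N : ℝ := 2 * ρ * C * (∫ x : ℝ, ‖G x‖ ∂μ) + 2 * ρ * C * S + 1
  have hN : 0 < N := by positivity
  let B : ℂ → ℂ := fun w => (w - v) ^ 2 * K G w / N
  have hBnorm : ∀ w, ‖B w‖ = ‖w - v‖ ^ 2 * ‖K G w‖ / N := fun w => by
    simp only [B, norm_div, norm_mul, norm_pow, Complex.norm_real, Real.norm_eq_abs,
      abs_of_pos hN]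
  have hBd : DifferentiableOn ℂ B (Metric.ball c ρ) := by
    have := (hKd G hG).mono him
    simp only [B]
    fun_prop
  have hBc : 0 < ‖B c‖ := by
    rw [hBnorm]
    have := norm_pos_iff.2 hcv
    have := norm_pos_iff.2 hKc
    positivity
  refine ⟨max 1 (-Real.log ‖B c‖), by positivity, fun F hF hF1 w hw => ?_⟩
  refine norm_le_exp_of_mul_bounded_ball (by positivity) hρ (hdb.1 F hF).differentiableOn hBd
    (fun z hz => ?_) (fun z hz => ?_) ?_ hw
  · rw [hBnorm, div_le_one hN]
    refine (hprod G hG z hz).trans ?_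
    have : 0 ≤ 2 * ρ * C * S := by positivity
    simp only [N]
    linarith
  · have e : F z * B z = (z - v) ^ 2 * K F z * G z / N := by
      simp only [B]
      rw [mul_div_assoc', mul_left_comm, hKG F hF z (him z hz)]
      ring
    rw [e, norm_div, norm_mul, norm_mul, norm_pow, Complex.norm_real, Real.norm_eq_abs,
      abs_of_pos hN, div_le_one hN]
    calc ‖z - v‖ ^ 2 * ‖K F z‖ * ‖G z‖ ≤ (2 * ρ * C * 1) * S := by
          refine mul_le_mul ((hprod F hF z hz).trans ?_) (hS z (Metric.ball_subset_closedBall hz))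
            (norm_nonneg _) (by positivity)
          gcongr
      _ ≤ N := by
          have : 0 ≤ 2 * ρ * C * (∫ x : ℝ, ‖G x‖ ∂μ) := by positivity
          simp only [N]
          linarith
  · rw [← Real.exp_log hBc, Real.exp_le_exp, Real.exp_log hBc]
    have := le_max_right 1 (-Real.log ‖B c‖)
    linarith

/-- The unit ball of a non-dense algebraic de Branges space is bounded on compact sets. -/
lemma exists_bound_on_closedBall {μ : Measure ℝ} [IsLocallyFiniteMeasure μ]
    {L : Submodule ℂ (ℂ → ℂ)} (hdb : IsAlgebraicDeBranges L)
    (hL : ∀ F ∈ L, Integrable (fun x : ℝ => F x) μ) (hnd : ¬ DenseL1 μ L) {R : ℝ} (hR : 0 < R) :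
    ∃ B : ℝ, ∀ F ∈ L, ∫ x : ℝ, ‖F x‖ ∂μ ≤ 1 → ∀ z : ℂ, ‖z‖ ≤ R → ‖F z‖ ≤ B := by
  by_cases hne : L = ⊥
  · refine ⟨0, fun F hF _ z _ => ?_⟩
    rw [hne, Submodule.mem_bot] at hF
    simp [hF]
  let a : ℝ := 2 * R
  have ha : 0 < a := by positivity
  have hρ : 0 < 2 * a := by positivity
  obtain ⟨M₁, hM₁, hb₁⟩ := exists_bound_on_tangent_ball hdb hL hnd hne a hρ
  obtain ⟨M₂, hM₂, hb₂⟩ := exists_bound_on_tangent_ball hdb hL hnd hne (-a) hρ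
  let C : ℝ := 16 * max M₁ M₂ * a
  have hC : 0 < C := by positivity
  have side : ∀ (v M : ℝ), M ≤ max M₁ M₂ → 0 < M → ∀ w : ℂ, |v - w.re| = w.im → 0 < w.im →
      w.im ≤ a → ‖w - (v + (2 * a : ℝ) * Complex.I)‖ < 2 * a ∧
      4 * M * (2 * a) / (2 * a - ‖w - (v + (2 * a : ℝ) * Complex.I)‖) ≤ C / w.im := by
    intro v M hM hM0 w hvw hw hwa
    have hn : ‖w - (v + (2 * a : ℝ) * Complex.I)‖ ≤ 2 * a - w.im / 2 := by
      rw [← sq_le_sq₀ (norm_nonneg _) (by linarith), Complex.sq_norm, Complex.normSq_apply]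
      have : (v - w.re) ^ 2 = w.im ^ 2 := by rw [← sq_abs, hvw]
      simp
      nlinarith
    refine ⟨by linarith, ?_⟩
    calc _ ≤ 4 * max M₁ M₂ * (2 * a) / (w.im / 2) := by
          gcongr
          linarith
      _ = C / w.im := by
          simp only [C]
          field_simp
          ring
  have upper : ∀ F ∈ L, ∫ x : ℝ, ‖F x‖ ∂μ ≤ 1 → ∀ w : ℂ, |w.re| + |w.im| = a → 0 < w.im →
      ‖F w‖ ≤ Real.exp (C / w.im) := by
    intro F hF hF1 w hw hpos
    rw [abs_of_pos hpos] at hw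
    have hwa : w.im ≤ a := by linarith [abs_nonneg w.re]
    rcases abs_cases w.re with ⟨h, h'⟩ | ⟨h, h'⟩
    · obtain ⟨h1, h2⟩ := side a M₁ (le_max_left _ _) hM₁ w
        (by rw [abs_of_nonneg] <;> linarith) hpos hwa
      exact (hb₁ F hF hF1 w h1).trans (Real.exp_le_exp.2 h2)
    · obtain ⟨h1, h2⟩ := side (-a) M₂ (le_max_right _ _) hM₂ w
        (by rw [abs_of_nonpos] <;> linarith) hpos hwa
      exact (hb₂ F hF hF1 w h1).trans (Real.exp_le_exp.2 h2)
  refine ⟨Real.exp (8 * C / a), fun F hF hF1 z hz => ?_⟩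
  refine norm_le_exp_of_bound_on_square (hdb.1 F hF) ha hC (fun w hw him => ?_)
    (by simpa [a] using hz)
  rcases lt_or_gt_of_ne him with him | him
  · have := upper _ (hdb.2.2 F hF) (by simpa using hF1) ((starRingEnd ℂ) w) (by simpa using hw)
      (by simpa using him)
    simpa [abs_of_neg him] using this
  · rw [abs_of_pos him]
    exact upper F hF hF1 w hw him

/-- Pitt's theorem, first part: if the algebraic de Branges space `𝓛` is contained
injectively in `L¹(μ)` and is not dense there, then the majorant `𝔪` is everywhere
finite and continuous. -/
theorem stmt10 (μ : Measure ℝ) [IsLocallyFiniteMeasure μ]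
    (L : Submodule ℂ (ℂ → ℂ)) (hdb : IsAlgebraicDeBranges L)
    (hint : ∀ F ∈ L, (∫⁻ x : ℝ, (‖F (x : ℂ)‖₊ : ℝ≥0∞) ∂μ) < ⊤)
    (hinj : ∀ F ∈ L, (∫⁻ x : ℝ, (‖F (x : ℂ)‖₊ : ℝ≥0∞) ∂μ) = 0 → F = 0)
    (hnd : ¬ DenseL1 μ L) :
    (∀ z : ℂ, L1Majorant μ L z ≠ ⊤) ∧
      Continuous (fun z : ℂ => (L1Majorant μ L z).toReal) := by
  have hL : ∀ F ∈ L, Integrable (fun x : ℝ => F x) μ := fun F hF =>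
    ⟨((hdb.1 F hF).continuous.comp Complex.continuous_ofReal).aestronglyMeasurable, hint F hF⟩
  have hle : ∀ F ∈ L, (∫⁻ x : ℝ, (‖F (x : ℂ)‖₊ : ℝ≥0∞) ∂μ) ≤ 1 → ∫ x : ℝ, ‖F x‖ ∂μ ≤ 1 :=
    fun F hF hF1 => by
      rwa [← ENNReal.ofReal_le_one, ofReal_integral_norm_eq_lintegral_enorm (hL F hF)]
  have hfin : ∀ z : ℂ, L1Majorant μ L z ≠ ⊤ := by
    intro z
    obtain ⟨B, hB⟩ := exists_bound_on_closedBall hdb hL hnd (R := ‖z‖ + 1) (by positivity)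
    refine ((iSup_le fun F => ?_).trans_lt (ENNReal.ofReal_lt_top (r := B))).ne
    rw [← enorm_eq_nnnorm, ← ofReal_norm]
    exact ENNReal.ofReal_le_ofReal (hB F.1 F.2.1 (hle _ F.2.1 F.2.2) z (by linarith))
  refine ⟨hfin, continuous_iff_continuousAt.2 fun z => ?_⟩
  obtain ⟨B, hB⟩ := exists_bound_on_closedBall hdb hL hnd (R := ‖z‖ + 1) (by positivity)
  have hB0 : 0 ≤ B := by
    simpa using hB 0 L.zero_mem (by simp) 0 (by simp; positivity)
  have hlip : ∀ F ∈ L, ∫ x : ℝ, ‖F x‖ ∂μ ≤ 1 → ∀ w, dist w z < 1 →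
      dist (F w) (F z) ≤ 2 * B * dist w z := by
    intro F hF hF1 w hw
    have hz := hB F hF hF1 z (by linarith)
    have := Complex.dist_le_div_mul_dist_of_mapsTo_ball (R₁ := 1) (R₂ := 2 * B) (c := z) (z := w)
      (hdb.1 F hF).differentiableOn (fun u hu => ?_) hw
    · simpa using this
    · have h1 : ‖u‖ ≤ ‖z‖ + 1 := by
        have := norm_sub_norm_le u z
        rw [Metric.mem_ball, dist_eq_norm] at hu
        linarith
      rw [Metric.mem_closedBall, dist_eq_norm]
      have := norm_sub_le_of_le (hB F hF hF1 u h1) hz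
      linarith
  have hcmp : ∀ u v : ℂ, (∀ F ∈ L, ∫ x : ℝ, ‖F x‖ ∂μ ≤ 1 → dist (F u) (F v) ≤ 2 * B * dist u v) →
      (L1Majorant μ L u).toReal ≤ (L1Majorant μ L v).toReal + 2 * B * dist u v := by
    intro u v huv
    have hnn : 0 ≤ 2 * B * dist u v := by positivity
    refine ENNReal.toReal_le_of_le_ofReal (by positivity) ?_
    rw [ENNReal.ofReal_add ENNReal.toReal_nonneg hnn, ENNReal.ofReal_toReal (hfin v)]
    refine iSup_le fun F => ?_
    have h1 : (‖F.1 u‖₊ : ℝ≥0∞) ≤ ‖F.1 v‖₊ + ENNReal.ofReal (2 * B * dist u v) := by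
      rw [← enorm_eq_nnnorm, ← enorm_eq_nnnorm, ← ofReal_norm, ← ofReal_norm,
        ← ENNReal.ofReal_add (norm_nonneg _) hnn]
      refine ENNReal.ofReal_le_ofReal ?_
      have := huv F.1 F.2.1 (hle _ F.2.1 F.2.2)
      rw [dist_eq_norm (F.1 u)] at this
      have := norm_sub_norm_le (F.1 u) (F.1 v)
      linarith
    refine h1.trans ?_
    gcongr
    exact le_iSup (fun F : {F : ℂ → ℂ // F ∈ L ∧
      (∫⁻ x : ℝ, (‖F (x : ℂ)‖₊ : ℝ≥0∞) ∂μ) ≤ 1} => (‖F.1 v‖₊ : ℝ≥0∞)) F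
  refine continuousAt_of_locally_lipschitz one_pos (2 * B) fun w hw => ?_
  have h1 := hcmp w z fun F hF hF1 => hlip F hF hF1 w hw
  have h2 := hcmp z w fun F hF hF1 => by
    rw [dist_comm, dist_comm z]
    exact hlip F hF hF1 w hw
  rw [dist_comm z] at h2
  rw [Real.dist_eq, abs_sub_le_iff]
  constructor <;> linarith
end
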